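/- arXiv:2310.01910 — 2 statements merged into one kernel-verified Lean document; each statement's English description precedes it below -/
import Mathlib

section
/- Let K be a nontrivial positive and multiplicatively cancellative commutative semiring, V a finite schema of variables with finite nonempty domains, and Σ ∪ {τ} a set of saturated conditional independencies and functional dependencies over V. The following are equivalent: (i) Σ implies τ over K-relations; (ii) Σ implies τ over Boolean-semiring relations whose support contains exactly two tuples; (iii) Σ implies τ over Boolean-semiring relations (equivalently, over ordinary relations). -/
/-! # Preliminaries: K-relations over semirings -/

open Finset

variable {V : Type*}

/-- A tuple over the finite set `X` of variables: it assigns to each variable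
`a ∈ X` a value in its domain `Dom a`. -/
abbrev Tup (Dom : V → Type*) (X : Finset V) : Type _ :=
  ∀ a : X, Dom a

/-- Restriction `t[Y]` of a tuple `t` over `X` to a subset `Y ⊆ X`. -/
def Tup.restrict {Dom : V → Type*} {X Y : Finset V} (h : Y ⊆ X) (t : Tup Dom X) :
    Tup Dom Y :=
  fun a => t ⟨a.1, h a.2⟩

open Classical in
/-- The marginal of a `K`-relation `R` over a schema `X` on a subset `Y ⊆ X`,
evaluated at a tuple `u` over `Y`: the sum of `R t` over all tuples `t` over `X`
with `t[Y] = u`. -/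
noncomputable def margin {K : Type*} [CommSemiring K] [DecidableEq V]
    {Dom : V → Type*} [∀ a, Fintype (Dom a)] {X Y : Finset V}
    (R : Tup Dom X → K) (h : Y ⊆ X) (u : Tup Dom Y) : K :=
  ∑ t : Tup Dom X, if Tup.restrict h t = u then R t else 0

open Classical in
/-- `c_S(u)`: the product of the marginal `S[Z]` over all tuples `v` in the
support of `S[Z]` different from `u` (empty products are `1`). -/
noncomputable def cfun {K : Type*} [CommSemiring K] [DecidableEq V]
    {Dom : V → Type*} [∀ a, Fintype (Dom a)] {Y Z : Finset V}
    (S : Tup Dom Y → K) (h : Z ⊆ Y) (u : Tup Dom Z) : K :=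
  ∏ v : Tup Dom Z, if margin S h v ≠ 0 ∧ v ≠ u then margin S h v else 1

/-- The join `R ⋈ S` of a `K`-relation `R` over `X` and a `K`-relation `S` over `Y`,
realized on the schema `T = X ∪ Y`:
`(R ⋈ S)(t) = R(t[X]) ⬝ S(t[Y]) ⬝ c_S(t[X ∩ Y])`. -/
noncomputable def joinOn {K : Type*} [CommSemiring K] [DecidableEq V]
    {Dom : V → Type*} [∀ a, Fintype (Dom a)] {X Y T : Finset V}
    (R : Tup Dom X → K) (S : Tup Dom Y → K)
    (hX : X ⊆ T) (hY : Y ⊆ T) (_hT : T ⊆ X ∪ Y) : Tup Dom T → K :=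
  fun t =>
    R (Tup.restrict hX t) * S (Tup.restrict hY t) *
      cfun (Z := X ∩ Y) S Finset.inter_subset_right
        (Tup.restrict ((Finset.inter_subset_right (s₁ := X)).trans hY) t)

/-- A `K`-relation `R` over the schema `S` satisfies the conditional independence
`CI(X; Y, Z)` (for `X, Y, Z ⊆ S`) if for every tuple `t` over `X ∪ Y ∪ Z`,
`R(t[X∪Y]) ⬝ R(t[X∪Z]) = R(t[X∪Y∪Z]) ⬝ R(t[X])`, all values being marginals of `R`. -/
def satCI {K : Type*} [CommSemiring K] [DecidableEq V]
    {Dom : V → Type*} [∀ a, Fintype (Dom a)] {S X Y Z : Finset V}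
    (R : Tup Dom S → K) (hX : X ⊆ S) (hY : Y ⊆ S) (hZ : Z ⊆ S) : Prop :=
  ∀ t : Tup Dom (X ∪ Y ∪ Z),
    margin R (Finset.union_subset hX hY) (Tup.restrict Finset.subset_union_left t) *
      margin R (Finset.union_subset hX hZ)
        (Tup.restrict (Finset.union_subset
          (Finset.subset_union_left.trans Finset.subset_union_left)
          Finset.subset_union_right) t) =
    margin R (Finset.union_subset (Finset.union_subset hX hY) hZ) t *
      margin R hX
        (Tup.restrict (Finset.subset_union_left.trans Finset.subset_union_left) t)

/-- A `K`-relation `R` over the schema `S` satisfies the functional dependency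
`U → W` if any two tuples in the support of `R` agreeing on `U` agree on `W`. -/
def satFD {K : Type*} [Zero K] {Dom : V → Type*} {S U W : Finset V}
    (R : Tup Dom S → K) (hU : U ⊆ S) (hW : W ⊆ S) : Prop :=
  ∀ t t' : Tup Dom S, R t ≠ 0 → R t' ≠ 0 →
    Tup.restrict hU t = Tup.restrict hU t' → Tup.restrict hW t = Tup.restrict hW t'

/-- Two `K`-relations over the same schema are equivalent (up to normalization),
`R ≡ R'`, if `aR = bR'` for some nonzero `a, b ∈ K`. -/
def equivRel {K : Type*} [CommSemiring K] {Dom : V → Type*} {X : Finset V}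
    (R R' : Tup Dom X → K) : Prop :=
  ∃ a b : K, a ≠ 0 ∧ b ≠ 0 ∧ ∀ t, a * R t = b * R' t

/-- `K` is `⊕`-positive: `a + b = 0` implies `a = b = 0`. -/
def plusPos (K : Type*) [CommSemiring K] : Prop :=
  ∀ a b : K, a + b = 0 → a = 0 ∧ b = 0

/-- `K` has no divisors of zero. -/
def noZD (K : Type*) [CommSemiring K] : Prop :=
  ∀ a b : K, a * b = 0 → a = 0 ∨ b = 0

/-- `K` is positive: `⊕`-positive and without zero divisors. -/
def posSemiring (K : Type*) [CommSemiring K] : Prop :=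
  plusPos K ∧ noZD K

/-- `K` is multiplicatively cancellative. -/
def mulCanc (K : Type*) [CommSemiring K] : Prop :=
  ∀ a b c : K, a ≠ 0 → a * b = a * c → b = c

/-- `K` is additively cancellative. -/
def addCanc (K : Type*) [CommSemiring K] : Prop :=
  ∀ a b c : K, a + b = a + c → b = c

/-- `K` is naturally totally ordered: the preorder `a ≤ b ↔ ∃ c, a + c = b`
is antisymmetric and total. -/
def natTotOrd (K : Type*) [CommSemiring K] : Prop :=
  (∀ a b : K, (∃ c, a + c = b) → (∃ c, b + c = a) → a = b) ∧
    (∀ a b : K, (∃ c, a + c = b) ∨ (∃ c, b + c = a))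

/-- `K` is a semifield: every nonzero element has a multiplicative inverse. -/
def isSemifield (K : Type*) [CommSemiring K] : Prop :=
  ∀ a : K, a ≠ 0 → ∃ b, a * b = 1

theorem subL [DecidableEq V] {X Y Z : Finset V} : X ⊆ X ∪ Y ∪ Z :=
  Finset.subset_union_left.trans Finset.subset_union_left

theorem subM [DecidableEq V] {X Y Z : Finset V} : Y ⊆ X ∪ Y ∪ Z :=
  Finset.subset_union_right.trans Finset.subset_union_left

theorem subR [DecidableEq V] {X Y Z : Finset V} : Z ⊆ X ∪ Y ∪ Z :=
  Finset.subset_union_right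

theorem subXY [DecidableEq V] {X Y Z : Finset V} : X ∪ Y ⊆ X ∪ Y ∪ Z :=
  Finset.subset_union_left

theorem subXZ [DecidableEq V] {X Y Z : Finset V} : X ∪ Z ⊆ X ∪ Y ∪ Z :=
  Finset.union_subset subL subR

theorem unionSplit [DecidableEq V] {X Y Z : Finset V} :
    X ∪ Y ∪ Z ⊆ (X ∪ Y) ∪ (X ∪ Z) := by
  intro a ha
  simp only [Finset.mem_union] at ha ⊢
  tauto

/-- The two-element Boolean semiring `𝔹 = ({0,1}, ∨, ∧, 0, 1)`. -/
def B2 : Type := Bool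

instance : DecidableEq B2 := inferInstanceAs (DecidableEq Bool)
instance : Fintype B2 := inferInstanceAs (Fintype Bool)

instance : CommSemiring B2 where
  add a b := Bool.or a b
  zero := Bool.false
  add_assoc := by decide
  zero_add := by decide
  add_zero := by decide
  add_comm := by decide
  mul a b := Bool.and a b
  one := Bool.true
  mul_assoc := by decide
  one_mul := by decide
  mul_one := by decide
  zero_mul := by decide
  mul_zero := by decide
  left_distrib := by decide
  right_distrib := by decide
  mul_comm := by decide
  nsmul n b := match n with | 0 => Bool.false | _ + 1 => b
  nsmul_zero := fun _ => rfl
  nsmul_succ := fun n x => match n with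
    | 0 => rfl
    | _ + 1 => (Bool.or_self x).symm

instance : Nontrivial B2 := ⟨0, 1, by decide⟩

/-- Constraints over the schema `V`: conditional independencies `CI(X; Y, Z)` and
functional dependencies `U → W`. -/
inductive Constraint (V : Type*) : Type _ where
  | ci (X Y Z : Finset V) : Constraint V
  | fd (U W : Finset V) : Constraint V

/-- Satisfaction of a constraint by a `K`-relation over the full schema `V`. -/
def Constraint.SatBy [DecidableEq V] [Fintype V] {Dom : V → Type*}
    [∀ a, Fintype (Dom a)] {K : Type*} [CommSemiring K]
    (σ : Constraint V) (R : Tup Dom (Finset.univ : Finset V) → K) : Prop :=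
  match σ with
  | .ci X Y Z =>
      satCI R (Finset.subset_univ X) (Finset.subset_univ Y) (Finset.subset_univ Z)
  | .fd U W => satFD R (Finset.subset_univ U) (Finset.subset_univ W)

/-- A constraint is a saturated CI (pairwise disjoint components covering the
schema) or a functional dependency. -/
def Constraint.SCIorFD [DecidableEq V] [Fintype V] : Constraint V → Prop
  | .ci X Y Z => Disjoint X Y ∧ Disjoint X Z ∧ Disjoint Y Z ∧ X ∪ Y ∪ Z = Finset.univ
  | .fd _ _ => True

/-- `Σ` implies `τ` over `K`-relations (with nonempty support) over the full schema `V`. -/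
def impliesOver [DecidableEq V] [Fintype V] (Dom : V → Type*) [∀ a, Fintype (Dom a)]
    (K : Type*) [CommSemiring K] (Sig : Set (Constraint V)) (τ : Constraint V) : Prop :=
  ∀ R : Tup Dom (Finset.univ : Finset V) → K, (∃ t, R t ≠ 0) →
    (∀ σ ∈ Sig, σ.SatBy R) → τ.SatBy R

/-- `Σ` implies `τ` over Boolean-semiring relations whose support contains
exactly two tuples. -/
def impliesOverTwoTuple [DecidableEq V] [Fintype V] (Dom : V → Type*)
    [∀ a, Fintype (Dom a)] (Sig : Set (Constraint V)) (τ : Constraint V) : Prop :=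
  ∀ R : Tup Dom (Finset.univ : Finset V) → B2,
    (∃ t t' : Tup Dom (Finset.univ : Finset V), t ≠ t' ∧ R t ≠ 0 ∧ R t' ≠ 0 ∧
      ∀ s, R s ≠ 0 → s = t ∨ s = t') →
    (∀ σ ∈ Sig, σ.SatBy R) → τ.SatBy R

section Helpers

open Classical in
/-- Swap: values of `p` on `Y`, values of `q` elsewhere. -/
noncomputable def sw {V : Type*} {Dom : V → Type*} {S : Finset V} (Y : Finset V)
    (p q : Tup Dom S) : Tup Dom S :=
  fun a => if a.1 ∈ Y then p a else q a

/-- Agreement on a set of variables. -/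
def agr {V : Type*} {Dom : V → Type*} {S : Finset V} (X : Finset V)
    (p q : Tup Dom S) : Prop :=
  ∀ a : S, a.1 ∈ X → p a = q a

/-- The exchange property. -/
def exch {V : Type*} {Dom : V → Type*} {S : Finset V} {K : Type*} [CommSemiring K]
    (R : Tup Dom S → K) (X Y : Finset V) : Prop :=
  ∀ p q : Tup Dom S, agr X p q → R p * R q = R (sw Y p q) * R (sw Y q p)

theorem sum_zero_all {K ι : Type*} [CommSemiring K] (h : plusPos K) (s : Finset ι) (f : ι → K)
    (h0 : ∑ i ∈ s, f i = 0) : ∀ i ∈ s, f i = 0 := by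
  classical
  intro i hi
  rw [← Finset.add_sum_erase s f hi] at h0
  exact (h _ _ h0).1

open Classical in
/-- Marginal seen from a full tuple. -/
noncomputable def marg {V : Type*} [DecidableEq V] {Dom : V → Type*} [∀ a, Fintype (Dom a)]
    {S : Finset V} {K : Type*} [CommSemiring K]
    (R : Tup Dom S → K) (A : Finset V) (t : Tup Dom S) : K :=
  ∑ t' ∈ Finset.univ.filter (fun t' => agr A t' t), R t'

theorem margin_restrict {V : Type*} [DecidableEq V] {Dom : V → Type*} [∀ a, Fintype (Dom a)]
    {S : Finset V} {K : Type*} [CommSemiring K]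
    (R : Tup Dom S → K) {A : Finset V} (h : A ⊆ S) (t : Tup Dom S) :
    margin R h (Tup.restrict h t) = marg R A t := by
  classical
  unfold margin marg
  rw [Finset.sum_filter]
  apply Finset.sum_congr rfl
  intro t' _
  have : (Tup.restrict h t' = Tup.restrict h t) ↔ agr A t' t := by
    constructor
    · intro e a ha
      exact congrFun e ⟨a.1, ha⟩
    · intro e
      funext a
      exact e ⟨a.1, h a.2⟩ a.2
  by_cases hh : agr A t' t
  · rw [if_pos hh, if_pos (this.2 hh)]
  · rw [if_neg hh, if_neg (fun x => hh (this.1 x))]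

theorem marg_congr {V : Type*} [DecidableEq V] {Dom : V → Type*} [∀ a, Fintype (Dom a)]
    {S : Finset V} {K : Type*} [CommSemiring K]
    (R : Tup Dom S → K) {A : Finset V} {t t' : Tup Dom S} (h : agr A t t') :
    marg R A t = marg R A t' := by
  classical
  unfold marg
  congr 1
  ext u
  simp only [Finset.mem_filter, Finset.mem_univ, true_and]
  exact ⟨fun e a ha => (e a ha).trans (h a ha), fun e a ha => (e a ha).trans (h a ha).symm⟩

theorem marg_full {V : Type*} [DecidableEq V] {Dom : V → Type*} [∀ a, Fintype (Dom a)]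
    {S : Finset V} {K : Type*} [CommSemiring K]
    (R : Tup Dom S → K) {A : Finset V} (hA : S ⊆ A) (t : Tup Dom S) :
    marg R A t = R t := by
  classical
  unfold marg
  have : Finset.univ.filter (fun t' => agr A t' t) = {t} := by
    ext u
    simp only [Finset.mem_filter, Finset.mem_univ, true_and, Finset.mem_singleton]
    exact ⟨fun e => funext fun a => e a (hA a.2), fun e a _ => congrFun e a⟩
  rw [this, Finset.sum_singleton]

theorem satCI_iff_marg {V : Type*} [DecidableEq V] [Fintype V] {Dom : V → Type*}
    [∀ a, Fintype (Dom a)] {K : Type*} [CommSemiring K]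
    (R : Tup Dom (Finset.univ : Finset V) → K) {X Y Z : Finset V}
    (hU : X ∪ Y ∪ Z = Finset.univ) :
    satCI R (Finset.subset_univ X) (Finset.subset_univ Y) (Finset.subset_univ Z) ↔
      ∀ t, marg R (X ∪ Y) t * marg R (X ∪ Z) t = R t * marg R X t := by
  have key : ∀ t, R t = marg R (X ∪ Y ∪ Z) t := fun t => (marg_full R hU.symm.subset t).symm
  constructor
  · intro h t
    have := h (Tup.restrict (Finset.subset_univ _) t)
    rw [key]
    simp only [← margin_restrict R (Finset.subset_univ _)]
    exact this
  · intro h u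
    obtain ⟨t, rfl⟩ : ∃ t : Tup Dom (Finset.univ : Finset V),
        u = Tup.restrict (Finset.subset_univ _) t :=
      ⟨fun a => u ⟨a.1, hU.symm.subset a.2⟩, rfl⟩
    have := h t
    rw [key] at this
    simp only [← margin_restrict R (Finset.subset_univ _)] at this
    exact this

theorem satCI_iff_exch {V : Type*} [DecidableEq V] [Fintype V] {Dom : V → Type*}
    [∀ a, Fintype (Dom a)] {K : Type*} [CommSemiring K]
    (hpos : posSemiring K) (hmc : mulCanc K)
    (R : Tup Dom (Finset.univ : Finset V) → K) {X Y Z : Finset V}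
    (hXY : Disjoint X Y) (hYZ : Disjoint Y Z)
    (hU : X ∪ Y ∪ Z = Finset.univ) :
    satCI R (Finset.subset_univ X) (Finset.subset_univ Y) (Finset.subset_univ Z) ↔
      exch R X Y := by
  classical
  rw [satCI_iff_marg R hU]
  have hnXY : ∀ a, a ∈ X → a ∉ Y := fun a h h' => Finset.disjoint_left.1 hXY h h'
  have hnZY : ∀ a, a ∈ Z → a ∉ Y := fun a h h' => Finset.disjoint_left.1 hYZ h' h
  have hcov : ∀ a, a ∈ X ∨ a ∈ Y ∨ a ∈ Z := by
    intro a
    have : a ∈ X ∪ Y ∪ Z := hU.symm.subset (Finset.mem_univ a)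
    simpa [or_assoc] using this
  have aXY : ∀ p q : Tup Dom (Finset.univ : Finset V), agr X p q → agr (X ∪ Y) (sw Y p q) p := by
    intro p q h a ha
    by_cases hy : a.1 ∈ Y
    · simp [sw, hy]
    · have hx : a.1 ∈ X := by simpa [hy] using ha
      simp [sw, hy, h a hx]
  have aXZ : ∀ p q : Tup Dom (Finset.univ : Finset V), agr (X ∪ Z) (sw Y p q) q := by
    intro p q a ha
    have hy : a.1 ∉ Y := by
      rcases Finset.mem_union.1 ha with h | h
      · exact hnXY _ h
      · exact hnZY _ h
    simp [sw, hy]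
  have mono : ∀ {p q : Tup Dom (Finset.univ : Finset V)} {W : Finset V},
      agr (X ∪ W) p q → agr X p q := fun h a ha => h a (Finset.mem_union_left _ ha)
  constructor
  · intro h p q hpq
    have hqp : agr X q p := fun a ha => (hpq a ha).symm
    have e1 := h p
    have e2 := h q
    have e3 := h (sw Y p q)
    have e4 := h (sw Y q p)
    rw [marg_congr R (aXY p q hpq), marg_congr R (aXZ p q),
      marg_congr R (mono (aXZ p q))] at e3
    rw [marg_congr R (aXY q p hqp), marg_congr R (aXZ q p),
      marg_congr R (mono (aXZ q p)), marg_congr R hpq] at e4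
    rw [marg_congr R hpq] at e1
    by_cases hM : marg R X q = 0
    · have z := sum_zero_all hpos.1 _ _ hM
      have z1 : R p = 0 := z p (by simpa using hpq)
      have z2 : R (sw Y p q) = 0 := z _ (by simpa using mono (aXZ p q))
      rw [z1, z2]; simp
    · apply hmc _ _ _ hM
      apply hmc _ _ _ hM
      calc _ = (R p * marg R X q) * (R q * marg R X q) := by ring
        _ = (R (sw Y p q) * marg R X q) * (R (sw Y q p) * marg R X q) := by
            rw [← e1, ← e2, ← e3, ← e4]; ring
        _ = _ := by ring
  · intro h t
    unfold marg
    rw [Finset.sum_mul_sum, ← Finset.sum_product', Finset.mul_sum]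
    symm
    refine Finset.sum_bij' (fun v _ => (sw Y t v, sw Y v t)) (fun w _ => sw Y w.2 w.1)
      ?_ ?_ ?_ ?_ ?_
    · intro v hv
      have hv : agr X v t := by simpa using hv
      simp only [Finset.mem_product, Finset.mem_filter, Finset.mem_univ, true_and]
      exact ⟨aXY t v (fun a ha => (hv a ha).symm), aXZ v t⟩
    · rintro ⟨p, q⟩ hw
      simp only [Finset.mem_product, Finset.mem_filter, Finset.mem_univ, true_and] at hw ⊢
      intro a ha
      exact (mono (aXZ q p) a ha).trans (mono hw.1 a ha)
    · intro v _
      funext a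
      by_cases hy : a.1 ∈ Y <;> simp [sw, hy]
    · rintro ⟨p, q⟩ hw
      simp only [Finset.mem_product, Finset.mem_filter, Finset.mem_univ, true_and] at hw
      refine Prod.ext ?_ ?_
      · funext a
        by_cases hy : a.1 ∈ Y
        · simp [sw, hy, hw.1 a (Finset.mem_union_right _ hy)]
        · simp [sw, hy]
      · funext a
        by_cases hy : a.1 ∈ Y
        · simp [sw, hy]
        · have : a.1 ∈ X ∪ Z := by
            rcases hcov a.1 with h | h | h
            · exact Finset.mem_union_left _ h
            · exact absurd h hy
            · exact Finset.mem_union_right _ h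
          simp [sw, hy, hw.2 a this]
    · intro v hv
      have hv : agr X v t := by simpa using hv
      exact h t v (fun a ha => (hv a ha).symm)

theorem pos_B2 : posSemiring B2 := ⟨by unfold plusPos; decide, by unfold noZD; decide⟩

theorem canc_B2 : mulCanc B2 := by unfold mulCanc; decide

theorem sq_inj {K : Type*} [CommSemiring K] (hpos : posSemiring K) (hmc : mulCanc K)
    (x y : K) (h : x * x = y * y) : x = y := by
  by_cases hs : x + y = 0
  · obtain ⟨hx, hy⟩ := hpos.1 _ _ hs
    rw [hx, hy]
  · apply hmc _ _ _ hs
    calc (x + y) * x = x * x + x * y := by ring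
      _ = (x + y) * y := by rw [h]; ring

open Classical in
/-- 0/1 copy of a relation. -/
noncomputable def ind {V : Type*} {Dom : V → Type*} {S : Finset V} (K : Type*) [CommSemiring K]
    (P : Tup Dom S → Prop) : Tup Dom S → K := fun t => if P t then 1 else 0

theorem ind_ne {V : Type*} {Dom : V → Type*} {S : Finset V} (K : Type*) [CommSemiring K]
    [Nontrivial K] (P : Tup Dom S → Prop) (t : Tup Dom S) : ind K P t ≠ 0 ↔ P t := by
  unfold ind
  by_cases h : P t <;> simp [h]

theorem ind_mul_eq {V : Type*} {Dom : V → Type*} {S : Finset V} (K : Type*) [CommSemiring K]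
    [Nontrivial K] (P : Tup Dom S → Prop) (p q r s : Tup Dom S) :
    ind K P p * ind K P q = ind K P r * ind K P s ↔ ((P p ∧ P q) ↔ (P r ∧ P s)) := by
  unfold ind
  by_cases h1 : P p <;> by_cases h2 : P q <;> by_cases h3 : P r <;> by_cases h4 : P s <;>
    simp [h1, h2, h3, h4]

theorem eq_ind_B2 {V : Type*} {Dom : V → Type*} {S : Finset V} (R : Tup Dom S → B2) :
    R = ind B2 (fun t => R t ≠ 0) := by
  classical
  funext t
  unfold ind
  have : ∀ x : B2, x = if x ≠ 0 then 1 else 0 := by decide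
  by_cases h : R t = 0
  · simp [h]
  · rw [if_pos h]
    have := this (R t)
    rwa [if_pos h] at this

theorem satBy_ind {V : Type*} [DecidableEq V] [Fintype V] {Dom : V → Type*}
    [∀ a, Fintype (Dom a)] {K : Type*} [CommSemiring K] [Nontrivial K]
    (hpos : posSemiring K) (hmc : mulCanc K)
    (P : Tup Dom (Finset.univ : Finset V) → Prop) (σ : Constraint V) (hσ : σ.SCIorFD) :
    σ.SatBy (ind K P) ↔ σ.SatBy (ind B2 P) := by
  cases σ with
  | ci X Y Z =>
    obtain ⟨h1, -, h3, h4⟩ := hσ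
    simp only [Constraint.SatBy]
    rw [satCI_iff_exch hpos hmc _ h1 h3 h4, satCI_iff_exch pos_B2 canc_B2 _ h1 h3 h4]
    simp only [exch, ind_mul_eq]
  | fd U W =>
    simp only [Constraint.SatBy, satFD, ind_ne]

theorem sw_eq_left {V : Type*} {Dom : V → Type*} {S : Finset V} {Y : Finset V}
    {p q : Tup Dom S} (h : ∀ a : S, a.1 ∉ Y → p a = q a) : sw Y p q = p := by
  funext a
  by_cases hy : a.1 ∈ Y
  · simp [sw, hy]
  · simp [sw, hy, h a hy]

theorem sw_eq_right {V : Type*} {Dom : V → Type*} {S : Finset V} {Y : Finset V}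
    {p q : Tup Dom S} (h : ∀ a : S, a.1 ∈ Y → p a = q a) : sw Y p q = q := by
  funext a
  by_cases hy : a.1 ∈ Y
  · simp [sw, hy, h a hy]
  · simp [sw, hy]

theorem sw_sw {V : Type*} {Dom : V → Type*} {S : Finset V} {Y : Finset V}
    {p q : Tup Dom S} : sw Y (sw Y p q) (sw Y q p) = p := by
  funext a
  by_cases hy : a.1 ∈ Y <;> simp [sw, hy]

theorem agr_sw {V : Type*} {Dom : V → Type*} {S : Finset V} {X Y : Finset V}
    {p q p' q' : Tup Dom S} (t : Tup Dom S) (h1 : agr X p t) (h2 : agr X q t)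
    (h3 : agr X p' t) (h4 : agr X q' t) : agr X (sw Y p q) (sw Y p' q') := by
  intro a ha
  by_cases hy : a.1 ∈ Y <;> simp [sw, hy, h1 a ha, h2 a ha, h3 a ha, h4 a ha]

/-- The pair relation satisfies exchange unless the pair agrees on `X` and differs both
inside and outside `Y`. -/
theorem pair_exch {V : Type*} {Dom : V → Type*} {S : Finset V} {X Y : Finset V}
    (t1 t2 : Tup Dom S)
    (h : agr X t1 t2 → (∀ a : S, a.1 ∈ Y → t1 a = t2 a) ∨ (∀ a : S, a.1 ∉ Y → t1 a = t2 a)) :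
    exch (ind B2 (fun s => s = t1 ∨ s = t2)) X Y := by
  have key : ∀ p q : Tup Dom S, agr X p q → ((p = t1 ∨ p = t2) ∧ (q = t1 ∨ q = t2)) →
      ((sw Y p q = t1 ∨ sw Y p q = t2) ∧ (sw Y q p = t1 ∨ sw Y q p = t2)) := by
    rintro p q hpq ⟨hp, hq⟩
    have h' : (∀ a : S, a.1 ∈ Y → p a = q a) ∨ (∀ a : S, a.1 ∉ Y → p a = q a) := by
      rcases hp with rfl | rfl <;> rcases hq with rfl | rfl
      · exact Or.inl fun _ _ => rfl
      · exact h hpq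
      · rcases h (fun a ha => (hpq a ha).symm) with h | h
        · exact Or.inl fun a ha => (h a ha).symm
        · exact Or.inr fun a ha => (h a ha).symm
      · exact Or.inl fun _ _ => rfl
    rcases h' with h' | h'
    · rw [sw_eq_right h', sw_eq_right (fun a ha => (h' a ha).symm)]
      exact ⟨hq, hp⟩
    · rw [sw_eq_left h', sw_eq_left (fun a ha => (h' a ha).symm)]
      exact ⟨hp, hq⟩
  intro p q hpq
  rw [ind_mul_eq]
  refine ⟨key p q hpq, fun hs => ?_⟩
  have := key (sw Y p q) (sw Y q p) (agr_sw q hpq (fun _ _ => rfl) (fun _ _ => rfl) hpq) hs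
  rwa [sw_sw, sw_sw] at this

theorem dichotomy {V : Type*} [DecidableEq V] [Fintype V] {Dom : V → Type*}
    [∀ a, Fintype (Dom a)] {K : Type*} [CommSemiring K]
    (hpos : posSemiring K) (hmc : mulCanc K)
    (Sig : Set (Constraint V)) (τ : Constraint V) (hSig : ∀ σ ∈ Sig, σ.SCIorFD)
    (h2 : impliesOverTwoTuple Dom Sig τ)
    (R : Tup Dom (Finset.univ : Finset V) → K) (hR : ∀ σ ∈ Sig, σ.SatBy R)
    (t1 t2 : Tup Dom (Finset.univ : Finset V)) (hne : t1 ≠ t2) (hR1 : R t1 ≠ 0)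
    (hR2 : R t2 ≠ 0) :
    τ.SatBy (ind B2 (fun s => s = t1 ∨ s = t2)) ∨
      ∃ U P : Finset V, exch R U P ∧ agr U t1 t2 ∧
        (∃ a : (Finset.univ : Finset V), a.1 ∈ P ∧ t1 a ≠ t2 a) ∧
        (∃ a : (Finset.univ : Finset V), a.1 ∉ P ∧ t1 a ≠ t2 a) := by
  by_contra hcon
  push Not at hcon
  obtain ⟨hτ, hno⟩ := hcon
  apply hτ
  apply h2
  · exact ⟨t1, t2, hne, (ind_ne _ _ _).2 (Or.inl rfl), (ind_ne _ _ _).2 (Or.inr rfl),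
      fun s hs => (ind_ne _ _ _).1 hs⟩
  · intro σ hσ
    have hs := hR σ hσ
    have hc := hSig σ hσ
    cases σ with
    | ci X Y Z =>
      obtain ⟨d1, -, d3, d4⟩ := hc
      simp only [Constraint.SatBy] at hs ⊢
      rw [satCI_iff_exch hpos hmc _ d1 d3 d4] at hs
      rw [satCI_iff_exch pos_B2 canc_B2 _ d1 d3 d4]
      apply pair_exch
      intro hag
      by_contra hh
      push Not at hh
      obtain ⟨⟨a, ha, hna⟩, ⟨b, hb, hnb⟩⟩ := hh
      exact hnb (hno X Y hs hag ⟨a, ha, hna⟩ b hb)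
    | fd U W =>
      simp only [Constraint.SatBy] at hs ⊢
      intro p q hp hq
      rw [ind_ne] at hp hq
      apply hs
      · rcases hp with rfl | rfl <;> assumption
      · rcases hq with rfl | rfl <;> assumption

open Classical in
/-- Number of disagreements. -/
noncomputable def dis {V : Type*} {Dom : V → Type*} {S : Finset V} (p q : Tup Dom S) : ℕ :=
  (Finset.univ.filter (fun a : S => p a ≠ q a)).card

theorem dis_lt {V : Type*} {Dom : V → Type*} {S : Finset V} {p q t1 t2 : Tup Dom S}
    (h : ∀ a, t1 a = t2 a → p a = q a) (h' : ∃ a, t1 a ≠ t2 a ∧ p a = q a) :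
    dis p q < dis t1 t2 := by
  classical
  unfold dis
  apply Finset.card_lt_card
  rw [Finset.ssubset_iff_of_subset]
  · obtain ⟨a, h1, h2⟩ := h'
    exact ⟨a, by simpa using h1, by simpa using h2⟩
  · intro a ha
    simp only [Finset.mem_filter, Finset.mem_univ, true_and] at ha ⊢
    exact fun e => ha (h a e)

theorem dis_sw {V : Type*} {Dom : V → Type*} {S : Finset V} (Y : Finset V) (p q : Tup Dom S) :
    dis (sw Y p q) (sw Y q p) = dis p q := by
  classical
  unfold dis
  congr 1
  ext a
  simp only [Finset.mem_filter, Finset.mem_univ, true_and]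
  by_cases hy : a.1 ∈ Y
  · simp [sw, hy]
  · simp [sw, hy, eq_comm]

theorem two_to_K {V : Type*} [DecidableEq V] [Fintype V] {Dom : V → Type*}
    [∀ a, Fintype (Dom a)] {K : Type*} [CommSemiring K]
    (hpos : posSemiring K) (hmc : mulCanc K)
    (Sig : Set (Constraint V)) (τ : Constraint V) (hSig : ∀ σ ∈ Sig, σ.SCIorFD)
    (hτ : τ.SCIorFD)
    (h2 : impliesOverTwoTuple Dom Sig τ) : impliesOver Dom K Sig τ := by
  intro R _ hR
  have dich := dichotomy hpos hmc Sig τ hSig h2 R hR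
  cases τ with
  | fd U W =>
    simp only [Constraint.SatBy] at dich ⊢
    have main : ∀ n : ℕ, ∀ t1 t2 : Tup Dom (Finset.univ : Finset V), dis t1 t2 = n →
        R t1 ≠ 0 → R t2 ≠ 0 → agr U t1 t2 → agr W t1 t2 := by
      intro n
      induction n using Nat.strong_induction_on with
      | _ n ih =>
        intro t1 t2 hn hR1 hR2 hag
        by_cases hne : t1 = t2
        · subst hne
          exact fun _ _ => rfl
        rcases dich t1 t2 hne hR1 hR2 with hs | ⟨X, P, hex, hX, ⟨a, haP, ha⟩, ⟨b, hbP, hb⟩⟩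
        · have := hs t1 t2 ((ind_ne _ _ _).2 (Or.inl rfl)) ((ind_ne _ _ _).2 (Or.inr rfl))
            (funext fun a => hag ⟨a.1, Finset.mem_univ _⟩ a.2)
          intro a ha
          exact congrFun this ⟨a.1, ha⟩
        · have e := hex t1 t2 hX
          have hR3 : R (sw P t1 t2) ≠ 0 := by
            intro h0
            rw [h0, zero_mul] at e
            rcases hpos.2 _ _ e with h | h
            · exact hR1 h
            · exact hR2 h
          have l1 : dis t1 (sw P t1 t2) < n := by
            rw [← hn]
            refine dis_lt (fun c hc => ?_) ⟨a, ha, by simp [sw, haP]⟩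
            by_cases hy : c.1 ∈ P <;> simp [sw, hy, hc]
          have l2 : dis (sw P t1 t2) t2 < n := by
            rw [← hn]
            refine dis_lt (fun c hc => ?_) ⟨b, hb, by simp [sw, hbP]⟩
            by_cases hy : c.1 ∈ P <;> simp [sw, hy, hc]
          have a1 : agr U t1 (sw P t1 t2) := by
            intro c hc
            by_cases hy : c.1 ∈ P <;> simp [sw, hy, hag c hc]
          have a2 : agr U (sw P t1 t2) t2 := fun c hc => (a1 c hc).symm.trans (hag c hc)
          intro c hc
          exact (ih _ l1 _ _ rfl hR1 hR3 a1 c hc).trans (ih _ l2 _ _ rfl hR3 hR2 a2 c hc)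
    intro t t' h1 h2 he
    funext a
    exact main _ t t' rfl h1 h2 (fun c hc => congrFun he ⟨c.1, hc⟩) ⟨a.1, Finset.mem_univ _⟩ a.2
  | ci X Y Z =>
    obtain ⟨d1, -, d3, d4⟩ := hτ
    simp only [Constraint.SatBy] at dich ⊢
    rw [satCI_iff_exch hpos hmc _ d1 d3 d4]
    simp only [satCI_iff_exch pos_B2 canc_B2 _ d1 d3 d4] at dich
    have main : ∀ n : ℕ, ∀ t1 t2 : Tup Dom (Finset.univ : Finset V), dis t1 t2 = n →
        agr X t1 t2 → R t1 * R t2 = R (sw Y t1 t2) * R (sw Y t2 t1) := by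
      intro n
      induction n using Nat.strong_induction_on with
      | _ n ih =>
        have nz : ∀ t1 t2 : Tup Dom (Finset.univ : Finset V), dis t1 t2 = n →
            agr X t1 t2 → R t1 ≠ 0 → R t2 ≠ 0 →
            R t1 * R t2 = R (sw Y t1 t2) * R (sw Y t2 t1) := by
          intro t1 t2 hn hag hR1 hR2
          by_cases hne : t1 = t2
          · subst hne
            rw [sw_eq_left (fun _ _ => rfl)]
          rcases dich t1 t2 hne hR1 hR2 with hs | ⟨U, P, hex, hU, ⟨a, haP, ha⟩, ⟨b, hbP, hb⟩⟩
          · have := ((ind_mul_eq _ _ _ _ _ _).1 (hs t1 t2 hag)).1 ⟨Or.inl rfl, Or.inr rfl⟩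
            rcases this.1 with h | h
            · have : sw Y t2 t1 = t2 := by
                apply sw_eq_left
                intro c hc
                have := congrFun h c
                simpa [sw, hc] using this
              rw [h, this]
            · have : sw Y t2 t1 = t1 := by
                apply sw_eq_right
                intro c hc
                have := congrFun h c
                simpa [sw, hc] using this.symm
              rw [h, this, mul_comm]
          · apply sq_inj hpos hmc
            -- the combinations of `t1` and `t2`
            have E0 := hex t1 t2 hU
            have rX : agr X t2 t2 := fun _ _ => rfl
            have rU : agr U t2 t2 := fun _ _ => rfl
            have X3 : agr X (sw P t1 t2) t2 := by
              intro c hc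
              by_cases hy : c.1 ∈ P <;> simp [sw, hy, hag c hc]
            have X4 : agr X (sw P t2 t1) t2 := by
              intro c hc
              by_cases hy : c.1 ∈ P <;> simp [sw, hy, hag c hc]
            have U3 : agr U (sw P t1 t2) t2 := by
              intro c hc
              by_cases hy : c.1 ∈ P <;> simp [sw, hy, hU c hc]
            have U4 : agr U (sw P t2 t1) t2 := by
              intro c hc
              by_cases hy : c.1 ∈ P <;> simp [sw, hy, hU c hc]
            have E1 := ih (dis t1 (sw P t1 t2)) (by
              rw [← hn]
              refine dis_lt (fun c hc => ?_) ⟨a, ha, by simp [sw, haP]⟩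
              by_cases hy : c.1 ∈ P <;> simp [sw, hy, hc]) _ _ rfl
              (fun c hc => (hag c hc).trans (X3 c hc).symm)
            have E2 := ih (dis t2 (sw P t2 t1)) (by
              rw [← hn]
              refine dis_lt (fun c hc => ?_) ⟨a, ha, by simp [sw, haP]⟩
              by_cases hy : c.1 ∈ P <;> simp [sw, hy, hc]) _ _ rfl
              (fun c hc => (X4 c hc).symm)
            -- (1110, 0100) and (1011, 0001)
            have E3 := ih (dis (sw Y t1 (sw P t1 t2)) (sw Y (sw P t2 t1) t2)) (by
              rw [← hn]
              refine dis_lt (fun c hc => ?_) ⟨b, hb, by simp [sw, hbP]⟩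
              by_cases hy : c.1 ∈ P <;> by_cases hz : c.1 ∈ Y <;> simp [sw, hy, hz, hc]) _ _ rfl
              (agr_sw t2 hag X3 X4 rX)
            have E4 := ih (dis (sw Y (sw P t1 t2) t1) (sw Y t2 (sw P t2 t1))) (by
              rw [← hn]
              refine dis_lt (fun c hc => ?_) ⟨b, hb, by simp [sw, hbP]⟩
              by_cases hy : c.1 ∈ P <;> by_cases hz : c.1 ∈ Y <;> simp [sw, hy, hz, hc]) _ _ rfl
              (agr_sw t2 X3 hag rX X4)
            -- 0110 and 1001
            have E5 := hex (sw Y (sw P t2 t1) (sw P t1 t2)) (sw Y (sw P t1 t2) (sw P t2 t1))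
              (agr_sw t2 U4 U3 U3 U4)
            have i1 : sw Y (sw Y t1 (sw P t1 t2)) (sw Y (sw P t2 t1) t2) = sw Y t1 t2 := by
              funext c; by_cases hz : c.1 ∈ Y <;> simp [sw, hz]
            have i2 : sw Y (sw Y (sw P t2 t1) t2) (sw Y t1 (sw P t1 t2)) =
                sw Y (sw P t2 t1) (sw P t1 t2) := by
              funext c; by_cases hz : c.1 ∈ Y <;> simp [sw, hz]
            have i3 : sw Y (sw Y (sw P t1 t2) t1) (sw Y t2 (sw P t2 t1)) =
                sw Y (sw P t1 t2) (sw P t2 t1) := by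
              funext c; by_cases hz : c.1 ∈ Y <;> simp [sw, hz]
            have i4 : sw Y (sw Y t2 (sw P t2 t1)) (sw Y (sw P t1 t2) t1) = sw Y t2 t1 := by
              funext c; by_cases hz : c.1 ∈ Y <;> simp [sw, hz]
            have i5 : sw P (sw Y (sw P t2 t1) (sw P t1 t2)) (sw Y (sw P t1 t2) (sw P t2 t1)) =
                sw Y t2 t1 := by
              funext c; by_cases hz : c.1 ∈ Y <;> by_cases hy : c.1 ∈ P <;> simp [sw, hz, hy]
            have i6 : sw P (sw Y (sw P t1 t2) (sw P t2 t1)) (sw Y (sw P t2 t1) (sw P t1 t2)) =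
                sw Y t1 t2 := by
              funext c; by_cases hz : c.1 ∈ Y <;> by_cases hy : c.1 ∈ P <;> simp [sw, hz, hy]
            rw [i1, i2] at E3
            rw [i3, i4] at E4
            rw [i5, i6] at E5
            calc (R t1 * R t2) * (R t1 * R t2)
                = (R t1 * R t2) * (R (sw P t1 t2) * R (sw P t2 t1)) := by rw [← E0]
              _ = (R t1 * R (sw P t1 t2)) * (R t2 * R (sw P t2 t1)) := by ring
              _ = (R (sw Y t1 (sw P t1 t2)) * R (sw Y (sw P t2 t1) t2)) *
                  (R (sw Y (sw P t1 t2) t1) * R (sw Y t2 (sw P t2 t1))) := by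
                    rw [E1, E2]; ring
              _ = (R (sw Y t1 t2) * R (sw Y t2 t1)) *
                  (R (sw Y (sw P t2 t1) (sw P t1 t2)) * R (sw Y (sw P t1 t2) (sw P t2 t1))) := by
                    rw [E3, E4]; ring
              _ = _ := by rw [E5]; ring
        intro t1 t2 hn hag
        by_cases h1 : R t1 * R t2 = 0
        · by_contra hne
          rw [h1] at hne
          have z1 : R (sw Y t1 t2) ≠ 0 := fun h => hne (by rw [h, zero_mul])
          have z2 : R (sw Y t2 t1) ≠ 0 := fun h => hne (by rw [h, mul_zero])
          have := nz (sw Y t1 t2) (sw Y t2 t1) ((dis_sw Y t1 t2).trans hn)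
            (agr_sw t2 hag (fun _ _ => rfl) (fun _ _ => rfl) hag) z1 z2
          rw [sw_sw, sw_sw, h1] at this
          exact hne this.symm
        · exact nz t1 t2 hn hag (fun h => h1 (by rw [h, zero_mul]))
            (fun h => h1 (by rw [h, mul_zero]))
    exact fun p q h => main _ p q rfl h

end Helpers

/-- For implication of saturated CIs and FDs over a positive, multiplicatively
cancellative semiring `K`, the following are equivalent: implication over
`K`-relations, implication over two-tuple Boolean relations, and implication
over Boolean relations. -/
theorem sciFd_implication_equiv
    [DecidableEq V] [Fintype V] (Dom : V → Type*)
    [∀ a, Fintype (Dom a)] [∀ a, Nonempty (Dom a)]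
    (K : Type*) [CommSemiring K] [Nontrivial K]
    (hpos : posSemiring K) (hmc : mulCanc K)
    (Sig : Set (Constraint V)) (τ : Constraint V)
    (hSig : ∀ σ ∈ Sig, σ.SCIorFD) (hτ : τ.SCIorFD) :
    (impliesOver Dom K Sig τ ↔ impliesOverTwoTuple Dom Sig τ) ∧
      (impliesOverTwoTuple Dom Sig τ ↔ impliesOver Dom B2 Sig τ) := by
  have hK2 : impliesOver Dom K Sig τ → impliesOverTwoTuple Dom Sig τ := by
    rintro h R ⟨t, -, -, ht, -, -⟩ hR
    rw [eq_ind_B2 R] at hR ⊢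
    rw [← satBy_ind hpos hmc _ _ hτ]
    apply h
    · exact ⟨t, (ind_ne _ _ _).2 ht⟩
    · intro σ hσ
      rw [satBy_ind hpos hmc _ _ (hSig σ hσ)]
      exact hR σ hσ
  refine ⟨⟨hK2, two_to_K hpos hmc Sig τ hSig hτ⟩,
    ⟨two_to_K pos_B2 canc_B2 Sig τ hSig hτ, ?_⟩⟩
  rintro h R ⟨t, -, -, ht, -, -⟩ hR
  exact h R ⟨t, ht⟩ hR
end

section
/- Let V be a finite schema of variables with finite nonempty domains and Σ ∪ {τ} a finite set of conditional independence statements over V. Let K be a nontrivial commutative semiring that embeds, via an injective semiring homomorphism, into a naturally totally ordered, additively cancellative and multiplicatively cancellative commutative semiring. If Σ implies τ over ℝ≥0-relations (where ℝ≥0 is the semiring of nonnegative reals with usual addition and multiplication), then Σ implies τ over K-relations. -/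
/-! # Preliminaries: K-relations over semirings -/

open Finset

variable {V : Type*}

/-- A conditional independence statement `CI(X; Y, Z)`, given as a triple. -/
abbrev CITriple (V : Type*) := Finset V × Finset V × Finset V

/-- Satisfaction of a CI statement by a `K`-relation over the full schema `V`. -/
def CITriple.SatBy [DecidableEq V] [Fintype V] {Dom : V → Type*}
    [∀ a, Fintype (Dom a)] {K : Type*} [CommSemiring K]
    (σ : CITriple V) (R : Tup Dom (Finset.univ : Finset V) → K) : Prop :=
  satCI R (Finset.subset_univ σ.1) (Finset.subset_univ σ.2.1) (Finset.subset_univ σ.2.2)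

/-- The three components of a CI statement are pairwise disjoint. -/
def CITriple.PairwiseDisjoint {V : Type*} (σ : CITriple V) : Prop :=
  Disjoint σ.1 σ.2.1 ∧ Disjoint σ.1 σ.2.2 ∧ Disjoint σ.2.1 σ.2.2

/-- `Σ` implies `τ` over `K`-relations over the full schema `V`. -/
def impliesCIOver [DecidableEq V] [Fintype V] (Dom : V → Type*) [∀ a, Fintype (Dom a)]
    (K : Type*) [CommSemiring K] (Sig : Set (CITriple V)) (τ : CITriple V) : Prop :=
  ∀ R : Tup Dom (Finset.univ : Finset V) → K,
    (∀ σ ∈ Sig, CITriple.SatBy σ R) → CITriple.SatBy τ R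

set_option linter.unusedSectionVars false

/-! ## Ordered fields with the intermediate value property for polynomials -/

open Polynomial in
/-- The intermediate value property for polynomials. -/
def PIVT (R : Type*) [Field R] [LinearOrder R] [IsStrictOrderedRing R] : Prop :=
  ∀ (p : R[X]) (a b : R), a < b → p.eval a * p.eval b < 0 → ∃ r, a < r ∧ r < b ∧ p.eval r = 0

section ivt
open Polynomial

variable {R : Type*} [Field R] [LinearOrder R] [IsStrictOrderedRing R]

theorem PIVT.rolle_adj (hR : PIVT R) (p : R[X]) (hp : p ≠ 0) (a b : R) (hab : a < b)
    (ha : p.eval a = 0) (hb : p.eval b = 0) (hno : ∀ c, a < c → c < b → p.eval c ≠ 0) :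
    ∃ c, a < c ∧ c < b ∧ (derivative p).eval c = 0 := by
  obtain ⟨q, hq, hqa⟩ := Polynomial.exists_eq_pow_rootMultiplicity_mul_and_not_dvd p hp a
  have hm : p.rootMultiplicity a ≠ 0 := by
    have := (Polynomial.rootMultiplicity_pos hp).2 ha
    omega
  obtain ⟨m, hm⟩ := Nat.exists_eq_succ_of_ne_zero hm
  rw [hm] at hq
  have hq0 : q ≠ 0 := by rintro rfl; simp at hqa
  have hqb : q.eval b = 0 := by
    rw [hq] at hb
    simp only [eval_mul, eval_pow, eval_sub, eval_X, eval_C] at hb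
    have : b - a ≠ 0 := sub_ne_zero.2 hab.ne'
    simpa [this] using hb
  obtain ⟨g, hg, hgb⟩ := Polynomial.exists_eq_pow_rootMultiplicity_mul_and_not_dvd q hq0 b
  have hn : q.rootMultiplicity b ≠ 0 := by
    have := (Polynomial.rootMultiplicity_pos hq0).2 hqb
    omega
  obtain ⟨n, hn⟩ := Nat.exists_eq_succ_of_ne_zero hn
  rw [hn] at hg
  rw [Polynomial.dvd_iff_isRoot] at hqa hgb
  have hga : g.eval a ≠ 0 := by
    intro h
    apply hqa
    rw [hg]
    simp [h]
  replace hgb : g.eval b ≠ 0 := hgb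
  have hpos : 0 < g.eval a * g.eval b := by
    rcases lt_trichotomy (g.eval a * g.eval b) 0 with h | h | h
    · obtain ⟨r, h1, h2, h3⟩ := hR g a b hab h
      exact absurd (by rw [hq, hg]; simp [h3]) (hno r h1 h2)
    · simp [hga, hgb] at h
    · exact h
  let h : R[X] := C ((m : R) + 1) * (X - C b) * g + C ((n : R) + 1) * (X - C a) * g
    + (X - C a) * (X - C b) * derivative g
  have hder : derivative p = (X - C a) ^ m * (X - C b) ^ n * h := by
    rw [hq, hg]
    simp only [derivative_mul, derivative_pow, derivative_sub, derivative_X, derivative_C, h,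
      Nat.succ_eq_add_one, Nat.add_sub_cancel, Nat.cast_add, Nat.cast_one, map_add, map_one,
      map_natCast]
    ring
  have hs : h.eval a * h.eval b < 0 := by
    have h1 : h.eval a = ((m : R) + 1) * (a - b) * g.eval a := by simp [h]
    have h2 : h.eval b = ((n : R) + 1) * (b - a) * g.eval b := by simp [h]
    rw [h1, h2]
    have e : ((m : R) + 1) * (a - b) * g.eval a * (((n : R) + 1) * (b - a) * g.eval b)
      = -(((m : R) + 1) * ((n : R) + 1) * (b - a) ^ 2 * (g.eval a * g.eval b)) := by ring
    rw [e]
    have : 0 < b - a := sub_pos.2 hab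
    have : 0 < ((m : R) + 1) * ((n : R) + 1) * (b - a) ^ 2 * (g.eval a * g.eval b) := by
      positivity
    linarith
  obtain ⟨r, h1, h2, h3⟩ := hR h a b hab hs
  exact ⟨r, h1, h2, by rw [hder]; simp [h3]⟩

theorem PIVT.rolle (hR : PIVT R) (p : R[X]) (a b : R) (hab : a < b)
    (ha : p.eval a = 0) (hb : p.eval b = 0) :
    ∃ c, a < c ∧ c < b ∧ (derivative p).eval c = 0 := by
  by_cases hp : p = 0
  · obtain ⟨c, h1, h2⟩ := exists_between hab
    exact ⟨c, h1, h2, by simp [hp]⟩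
  let S := p.roots.toFinset.filter (fun x => a < x)
  have hbS : b ∈ S := by simp [S, hp, hb, hab]
  have hne : S.Nonempty := ⟨b, hbS⟩
  have hmem := S.min'_mem hne
  have hle := S.min'_le b hbS
  set b' := S.min' hne with hb'
  have h1 : a < b' := (Finset.mem_filter.1 hmem).2
  have h2 : p.eval b' = 0 := by
    have := (Finset.mem_filter.1 hmem).1
    simpa [hp] using this
  obtain ⟨c, hc1, hc2, hc3⟩ := hR.rolle_adj p hp a b' h1 ha h2 (by
    intro c h3 h4 h5
    have : c ∈ S := by simp [S, hp, h5, h3]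
    exact absurd (S.min'_le c this) (not_le.2 h4))
  exact ⟨c, hc1, lt_of_lt_of_le hc2 hle, hc3⟩

theorem PIVT.mvt (hR : PIVT R) (p : R[X]) (a b : R) (hab : a < b) :
    ∃ c, a < c ∧ c < b ∧ p.eval b - p.eval a = (derivative p).eval c * (b - a) := by
  have hne : b - a ≠ 0 := sub_ne_zero.2 hab.ne'
  obtain ⟨c, h1, h2, h3⟩ := hR.rolle
    (p - C (p.eval a) - C ((p.eval b - p.eval a) / (b - a)) * (X - C a)) a b hab
    (by simp) (by simp; field_simp; ring)
  refine ⟨c, h1, h2, ?_⟩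
  simp at h3
  have : eval c (derivative p) = (p.eval b - p.eval a) / (b - a) := by linarith
  rw [this]; field_simp

theorem PIVT.strictMono (hR : PIVT R) (p : R[X]) (a b : R) (hab : a < b)
    (h : ∀ c, a < c → c < b → 0 < (derivative p).eval c) : p.eval a < p.eval b := by
  obtain ⟨c, h1, h2, h3⟩ := hR.mvt p a b hab
  have := mul_pos (h c h1 h2) (sub_pos.2 hab)
  linarith

/-- behaviour at plus infinity -/
theorem poly_large (p : R[X]) (n : ℕ) (hn : p.natDegree = n + 1) (hl : 0 < p.leadingCoeff)
    (K : R) : ∃ N, ∀ x, N ≤ x → K < p.eval x := by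
  induction n generalizing p K with
  | zero =>
    have hp := Polynomial.eq_X_add_C_of_natDegree_le_one (p := p) (by omega)
    have hc : 0 < p.coeff 1 := by rw [leadingCoeff, hn] at hl; exact hl
    refine ⟨(K - p.coeff 0) / p.coeff 1 + 1, fun x hx => ?_⟩
    rw [hp]
    simp only [eval_add, eval_mul, eval_C, eval_X]
    have : (K - p.coeff 0) / p.coeff 1 < x := by linarith
    rw [div_lt_iff₀ hc] at this
    linarith
  | succ n ih =>
    have hd : (divX p).natDegree = n + 1 := by rw [natDegree_divX_eq_natDegree_tsub_one, hn]; omega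
    have hlc : (divX p).leadingCoeff = p.leadingCoeff := by
      rw [leadingCoeff, leadingCoeff, hd, hn, coeff_divX]
    obtain ⟨N, hN⟩ := ih (divX p) hd (by rw [hlc]; exact hl) 1
    refine ⟨max N (max 0 (K - p.coeff 0 + 1)), fun x hx => ?_⟩
    have h1 : N ≤ x := le_trans (le_max_left _ _) hx
    have h2 : 0 ≤ x := le_trans (le_trans (le_max_left _ _) (le_max_right _ _)) hx
    have h3 : K - p.coeff 0 + 1 ≤ x := le_trans (le_trans (le_max_right _ _) (le_max_right _ _)) hx
    have h4 := hN x h1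
    rw [← divX_mul_X_add p]
    simp only [eval_add, eval_mul, eval_C, eval_X]
    nlinarith

theorem PIVT.unbdd_above (hR : PIVT R) (p : R[X]) (hn : 1 ≤ p.natDegree) (x : R)
    (h : ∀ c, x < c → 0 < (derivative p).eval c) : ∃ y, x < y ∧ 0 < p.eval y := by
  by_contra! hcon
  obtain ⟨n, hn⟩ := Nat.exists_eq_add_of_le' hn
  have hp0 : p.leadingCoeff ≠ 0 := by
    rw [Ne, leadingCoeff_eq_zero]; rintro rfl; simp at hn
  rcases lt_or_gt_of_ne hp0 with hl | hl
  · obtain ⟨N, hN⟩ := poly_large (-p) n (by simpa using hn) (by simpa using hl) (-p.eval x)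
    have := hN (max N (x + 1)) (le_max_left _ _)
    rw [eval_neg] at this
    have h2 := hR.strictMono p x (max N (x + 1))
      (lt_of_lt_of_le (by linarith) (le_max_right _ _)) (fun c h1 _ => h c h1)
    linarith
  · obtain ⟨N, hN⟩ := poly_large p n hn hl 0
    have h1 := hN (max N (x + 1)) (le_max_left _ _)
    have h2 := hcon (max N (x + 1)) (lt_of_lt_of_le (by linarith) (le_max_right _ _))
    linarith

theorem PIVT.unbdd_below (hR : PIVT R) (p : R[X]) (hn : 1 ≤ p.natDegree) (x : R)
    (h : ∀ c, c < x → 0 < (derivative p).eval c) : ∃ y, y < x ∧ p.eval y < 0 := by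
  obtain ⟨y, h1, h2⟩ := hR.unbdd_above (-(p.comp (-X))) (by simpa [natDegree_comp] using hn) (-x) (by
    intro c hc
    have := h (-c) (by linarith)
    simpa [derivative_comp] using this)
  refine ⟨-y, by linarith, ?_⟩
  simpa using h2

/-- `y` lies in the same gap of `S` as `x`. -/
def Gap (S : Finset R) (x y : R) : Prop := ∀ s ∈ S, (s < x ↔ s < y) ∧ (x < s ↔ y < s)

theorem PIVT.rootBelow (hR : PIVT R) (S : Finset R) (p : R[X]) (hn : 1 ≤ p.natDegree) (x : R)
    (hxS : x ∉ S) (hx : 0 ≤ p.eval x) (hd : ∀ y, Gap S x y → 0 < (derivative p).eval y)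
    (hS : ∀ a ∈ S, a < x → (∀ s ∈ S, s < x → s ≤ a) → p.eval a < 0) :
    ∃ r, r ≤ x ∧ p.eval r = 0 ∧ Gap S x r := by
  have hxs : ∀ s ∈ S, s ≠ x := fun s hs h => hxS (h ▸ hs)
  rcases hx.eq_or_lt with hx | hx
  · exact ⟨x, le_rfl, hx.symm, fun s _ => by simp⟩
  suffices h : ∃ y, y < x ∧ p.eval y < 0 ∧ ∀ s ∈ S, s < x → s ≤ y by
    obtain ⟨y, h1, h2, h3⟩ := h
    obtain ⟨r, hr1, hr2, hr3⟩ := hR p y x h1 (mul_neg_of_neg_of_pos h2 hx)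
    refine ⟨r, hr2.le, hr3, fun s hs => ⟨⟨fun h => (h3 s hs h).trans_lt hr1, fun h => h.trans hr2⟩,
      fun h => hr2.trans h, fun h => ?_⟩⟩
    by_contra hc
    have := h3 s hs (lt_of_le_of_ne (not_lt.1 hc) (hxs s hs))
    exact absurd (hr1.trans h) (not_lt.2 this)
  by_cases hne : (S.filter (fun s => s < x)).Nonempty
  · have hm := Finset.max'_mem _ hne
    have hle := Finset.le_max' (S.filter (fun s => s < x))
    set a := (S.filter (fun s => s < x)).max' hne
    rw [Finset.mem_filter] at hm
    have h3 : ∀ s ∈ S, s < x → s ≤ a := fun s hs h => hle s (Finset.mem_filter.2 ⟨hs, h⟩)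
    exact ⟨a, hm.2, hS a hm.1 hm.2 h3, h3⟩
  · rw [Finset.not_nonempty_iff_eq_empty, Finset.filter_eq_empty_iff] at hne
    obtain ⟨y, h1, h2⟩ := hR.unbdd_below p hn x (fun c hc => hd c fun s hs => by
      have h1 : ¬ s < x := hne hs
      have h2 : x ≤ s := not_lt.1 h1
      have h3 : x < s := lt_of_le_of_ne h2 (hxs s hs).symm
      have h4 : c < s := hc.trans h3
      simp [h1, h3, h4, h4.le])
    exact ⟨y, h1, h2, fun s hs h => absurd h (hne hs)⟩

theorem PIVT.rootAbove (hR : PIVT R) (S : Finset R) (p : R[X]) (hn : 1 ≤ p.natDegree) (x : R)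
    (hxS : x ∉ S) (hx : p.eval x ≤ 0) (hd : ∀ y, Gap S x y → 0 < (derivative p).eval y)
    (hS : ∀ a ∈ S, x < a → (∀ s ∈ S, x < s → a ≤ s) → 0 < p.eval a) :
    ∃ r, x ≤ r ∧ p.eval r = 0 ∧ Gap S x r := by
  have hxs : ∀ s ∈ S, s ≠ x := fun s hs h => hxS (h ▸ hs)
  rcases hx.eq_or_lt with hx | hx
  · exact ⟨x, le_rfl, hx, fun s _ => by simp⟩
  suffices h : ∃ y, x < y ∧ 0 < p.eval y ∧ ∀ s ∈ S, x < s → y ≤ s by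
    obtain ⟨y, h1, h2, h3⟩ := h
    obtain ⟨r, hr1, hr2, hr3⟩ := hR p x y h1 (mul_neg_of_neg_of_pos hx h2)
    refine ⟨r, hr1.le, hr3, fun s hs => ⟨⟨fun h => h.trans hr1, fun h => ?_⟩,
      fun h => hr2.trans_le (h3 s hs h), fun h => hr1.trans h⟩⟩
    by_contra hc
    have := h3 s hs (lt_of_le_of_ne (not_lt.1 hc) (hxs s hs).symm)
    exact absurd (h.trans hr2) (not_lt.2 this)
  by_cases hne : (S.filter (fun s => x < s)).Nonempty
  · have hm := Finset.min'_mem _ hne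
    have hle := Finset.min'_le (S.filter (fun s => x < s))
    set a := (S.filter (fun s => x < s)).min' hne
    rw [Finset.mem_filter] at hm
    have h3 : ∀ s ∈ S, x < s → a ≤ s := fun s hs h => hle s (Finset.mem_filter.2 ⟨hs, h⟩)
    exact ⟨a, hm.2, hS a hm.1 hm.2 h3, h3⟩
  · rw [Finset.not_nonempty_iff_eq_empty, Finset.filter_eq_empty_iff] at hne
    obtain ⟨y, h1, h2⟩ := hR.unbdd_above p hn x (fun c hc => hd c fun s hs => by
      have h1 : ¬ x < s := hne hs
      have h2 : s ≤ x := not_lt.1 h1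
      have h3 : s < x := lt_of_le_of_ne h2 (hxs s hs)
      have h4 : s < c := h3.trans hc
      simp [h1, h3, h4, h4.le])
    exact ⟨y, h1, h2, fun s hs h => absurd h (hne hs)⟩

end ivt

/-! ## Matching of root patterns between two ordered fields -/

section matching
open Polynomial

/-- Same sign. -/
def SS {R₁ R₂ : Type*} [Field R₁] [LinearOrder R₁] [Field R₂] [LinearOrder R₂]
    (u : R₁) (v : R₂) : Prop := (0 < u ↔ 0 < v) ∧ (u < 0 ↔ v < 0)

variable {R₁ R₂ : Type*} [Field R₁] [LinearOrder R₁] [IsStrictOrderedRing R₁]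
  [Field R₂] [LinearOrder R₂] [IsStrictOrderedRing R₂]

theorem SS.zero_iff {u : R₁} {v : R₂} (h : SS u v) : u = 0 ↔ v = 0 := by
  constructor
  · rintro rfl
    have h1 := h.1; have h2 := h.2
    simp only [lt_irrefl, false_iff, not_lt] at h1 h2
    exact le_antisymm h1 h2
  · rintro rfl
    have h1 := h.1; have h2 := h.2
    simp only [lt_irrefl, iff_false, not_lt] at h1 h2
    exact le_antisymm h1 h2

theorem SS.neg {u : R₁} {v : R₂} (h : SS u v) : SS (-u) (-v) := by
  have h1 := h.1; have h2 := h.2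
  constructor <;> simp [*]

theorem SS.of_neg {u : R₁} {v : R₂} (h : SS (-u) (-v)) : SS u v := by
  simpa using h.neg

theorem SS.symm {u : R₁} {v : R₂} (h : SS u v) : SS v u := ⟨h.1.symm, h.2.symm⟩

/-- `x` and `y` have the same position relative to the matched points. -/
def MRel (M : Finset (R₁ × R₂)) (x : R₁) (y : R₂) : Prop :=
  ∀ p ∈ M, (p.1 < x ↔ p.2 < y) ∧ (x < p.1 ↔ y < p.2)

theorem MRel.eq_iff {M : Finset (R₁ × R₂)} {x : R₁} {y : R₂} (h : MRel M x y) {p : R₁ × R₂}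
    (hp : p ∈ M) : p.1 = x ↔ p.2 = y := by
  obtain ⟨h1, h2⟩ := h p hp
  constructor
  · intro e
    rw [e] at h1 h2
    simp only [lt_irrefl, false_iff, not_lt] at h1 h2
    exact le_antisymm h2 h1
  · intro e
    rw [e] at h1 h2
    simp only [lt_irrefl, iff_false, not_lt] at h1 h2
    exact le_antisymm h2 h1

theorem MRel.exists {M : Finset (R₁ × R₂)} (hM : ∀ p ∈ M, MRel M p.1 p.2) (x : R₁) :
    ∃ y, MRel M x y := by
  by_cases hx : ∃ p ∈ M, p.1 = x
  · obtain ⟨p, hp, rfl⟩ := hx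
    exact ⟨p.2, hM p hp⟩
  push Not at hx
  obtain ⟨y, h1, h2⟩ := Order.exists_between_finsets
    ((M.filter (fun p => p.1 < x)).image Prod.snd) ((M.filter (fun p => x < p.1)).image Prod.snd)
    (by
      intro a ha b hb
      simp only [Finset.mem_image, Finset.mem_filter] at ha hb
      obtain ⟨p, ⟨hp, hpx⟩, rfl⟩ := ha
      obtain ⟨q, ⟨hq, hqx⟩, rfl⟩ := hb
      exact ((hM q hq p hp).1).1 (hpx.trans hqx))
  refine ⟨y, fun p hp => ?_⟩
  rcases lt_or_gt_of_ne (hx p hp) with h | h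
  · have := h1 p.2 (Finset.mem_image_of_mem _ (Finset.mem_filter.2 ⟨hp, h⟩))
    simp [h, this, h.asymm, this.asymm]
  · have := h2 p.2 (Finset.mem_image_of_mem _ (Finset.mem_filter.2 ⟨hp, h⟩))
    simp [h, this, h.asymm, this.asymm]

theorem MRel.swap {M : Finset (R₁ × R₂)} {x : R₁} {y : R₂} (h : MRel M x y) :
    MRel (M.image Prod.swap) y x := by
  intro p hp
  simp only [Finset.mem_image] at hp
  obtain ⟨q, hq, rfl⟩ := hp
  exact ⟨(h q hq).1.symm, (h q hq).2.symm⟩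

theorem MRel.unswap {M : Finset (R₁ × R₂)} {x : R₁} {y : R₂} (h : MRel (M.image Prod.swap) y x) :
    MRel M x y := by
  intro p hp
  have := h p.swap (Finset.mem_image_of_mem _ hp)
  exact ⟨this.1.symm, this.2.symm⟩

theorem MRel.gap_left {M : Finset (R₁ × R₂)} {x y : R₁} {z : R₂} (h : MRel M x z)
    (hg : ∀ s ∈ M.image Prod.fst, (s < x ↔ s < y) ∧ (x < s ↔ y < s)) : MRel M y z := by
  intro p hp
  have h1 := hg p.1 (Finset.mem_image_of_mem _ hp)
  have h2 := h p hp
  exact ⟨h1.1.symm.trans h2.1, h1.2.symm.trans h2.2⟩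

theorem MRel.gap_right {M : Finset (R₁ × R₂)} {x : R₁} {y z : R₂} (h : MRel M x z)
    (hg : ∀ s ∈ M.image Prod.snd, (s < z ↔ s < y) ∧ (z < s ↔ y < s)) : MRel M x y := by
  intro p hp
  have h1 := hg p.2 (Finset.mem_image_of_mem _ hp)
  have h2 := h p hp
  exact ⟨h2.1.trans h1.1, h2.2.trans h1.2⟩

theorem match_core (h₁ : PIVT R₁) (h₂ : PIVT R₂) (M : Finset (R₁ × R₂))
    (hM : ∀ p ∈ M, MRel M p.1 p.2) (p₁ : R₁[X]) (p₂ : R₂[X])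
    (n₁ : 1 ≤ p₁.natDegree) (n₂ : 1 ≤ p₂.natDegree)
    (hs : ∀ q ∈ M, SS (p₁.eval q.1) (p₂.eval q.2)) (x : R₁) (y : R₂) (hr : MRel M x y)
    (hx : x ∉ M.image Prod.fst) (hy : y ∉ M.image Prod.snd)
    (d₁ : ∀ z, Gap (M.image Prod.fst) x z → 0 < (derivative p₁).eval z)
    (d₂ : ∀ z, Gap (M.image Prod.snd) y z → 0 < (derivative p₂).eval z)
    (hpx : 0 ≤ p₁.eval x) (hpy : p₂.eval y ≤ 0) :
    ∃ r s, r ≤ x ∧ y ≤ s ∧ p₁.eval r = 0 ∧ p₂.eval s = 0 ∧ MRel M r s := by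
  obtain ⟨r, hr1, hr2, hr3⟩ := h₁.rootBelow (M.image Prod.fst) p₁ n₁ x hx hpx d₁ (by
    intro a ha hax hadj
    obtain ⟨q, hq, rfl⟩ := Finset.mem_image.1 ha
    have hqy : q.2 < y := (hr q hq).1.1 hax
    have := h₂.strictMono p₂ q.2 y hqy (by
      intro c hc1 hc2
      apply d₂
      intro s hs
      obtain ⟨q', hq', rfl⟩ := Finset.mem_image.1 hs
      have key : q'.2 < y → q'.2 ≤ q.2 := by
        intro h
        have h1 := hadj q'.1 (Finset.mem_image_of_mem _ hq') ((hr q' hq').1.2 h)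
        by_contra hc
        exact absurd (((hM q hq) q' hq').2.2 (not_le.1 hc)) (not_lt.2 h1)
      have hne : q'.2 ≠ y := fun h => hy (h ▸ hs)
      refine ⟨⟨fun h => (key h).trans_lt hc1, fun h => h.trans hc2⟩, fun h => hc2.trans h,
        fun h => ?_⟩
      by_contra hc
      exact absurd (key (lt_of_le_of_ne (not_lt.1 hc) hne)) (not_le.2 (hc1.trans h)))
    exact (hs q hq).2.2 (by linarith))
  obtain ⟨s, hs1, hs2, hs3⟩ := h₂.rootAbove (M.image Prod.snd) p₂ n₂ y hy hpy d₂ (by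
    intro a ha hax hadj
    obtain ⟨q, hq, rfl⟩ := Finset.mem_image.1 ha
    have hqy : x < q.1 := (hr q hq).2.2 hax
    have := h₁.strictMono p₁ x q.1 hqy (by
      intro c hc1 hc2
      apply d₁
      intro s hs
      obtain ⟨q', hq', rfl⟩ := Finset.mem_image.1 hs
      have key : x < q'.1 → q.1 ≤ q'.1 := by
        intro h
        have h1 := hadj q'.2 (Finset.mem_image_of_mem _ hq') ((hr q' hq').2.1 h)
        by_contra hc
        exact absurd (((hM q hq) q' hq').1.1 (not_le.1 hc)) (not_lt.2 h1)
      have hne : q'.1 ≠ x := fun h => hx (h ▸ hs)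
      refine ⟨⟨fun h => h.trans hc1, fun h => ?_⟩, fun h => hc2.trans_le (key h),
        fun h => hc1.trans h⟩
      by_contra hc
      exact absurd (key (lt_of_le_of_ne (not_lt.1 hc) hne.symm)) (not_le.2 (h.trans hc2)))
    exact (hs q hq).1.1 (by linarith))
  exact ⟨r, s, hr1, hs1, hr2, hs2, (hr.gap_left hr3).gap_right hs3⟩

theorem match_noncross (h₁ : PIVT R₁) (h₂ : PIVT R₂) (M : Finset (R₁ × R₂))
    (hM : ∀ p ∈ M, MRel M p.1 p.2) (p₁ : R₁[X]) (p₂ : R₂[X])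
    (n₁ : 1 ≤ p₁.natDegree) (n₂ : 1 ≤ p₂.natDegree)
    (hs : ∀ q ∈ M, SS (p₁.eval q.1) (p₂.eval q.2)) (x : R₁) (y : R₂) (hr : MRel M x y)
    (hx : x ∉ M.image Prod.fst) (hy : y ∉ M.image Prod.snd)
    (d₁ : ∀ z, Gap (M.image Prod.fst) x z → 0 < (derivative p₁).eval z)
    (d₂ : ∀ z, Gap (M.image Prod.snd) y z → 0 < (derivative p₂).eval z)
    (hroot : ∀ r s, p₁.eval r = 0 → p₂.eval s = 0 → MRel M r s →
      (r < x ↔ s < y) ∧ (x < r ↔ y < s))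
    (hpx : 0 ≤ p₁.eval x) (hpy : p₂.eval y ≤ 0) : p₁.eval x = 0 ∧ p₂.eval y = 0 := by
  obtain ⟨r, s, h1, h2, h3, h4, h5⟩ :=
    match_core h₁ h₂ M hM p₁ p₂ n₁ n₂ hs x y hr hx hy d₁ d₂ hpx hpy
  obtain ⟨h6, h7⟩ := hroot r s h3 h4 h5
  have e1 : r = x := by
    by_contra hc
    exact absurd (h6.1 (lt_of_le_of_ne h1 hc)) (not_lt.2 h2)
  have e2 : s = y := by
    by_contra hc
    exact absurd (h7.2 (lt_of_le_of_ne h2 (Ne.symm hc))) (not_lt.2 h1)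
  subst e1 e2
  exact ⟨h3, h4⟩

theorem match_pos (h₁ : PIVT R₁) (h₂ : PIVT R₂) (M : Finset (R₁ × R₂))
    (hM : ∀ p ∈ M, MRel M p.1 p.2) (p₁ : R₁[X]) (p₂ : R₂[X])
    (n₁ : 1 ≤ p₁.natDegree) (n₂ : 1 ≤ p₂.natDegree)
    (hs : ∀ q ∈ M, SS (p₁.eval q.1) (p₂.eval q.2)) (x : R₁) (y : R₂) (hr : MRel M x y)
    (hx : x ∉ M.image Prod.fst) (hy : y ∉ M.image Prod.snd)
    (d₁ : ∀ z, Gap (M.image Prod.fst) x z → 0 < (derivative p₁).eval z)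
    (d₂ : ∀ z, Gap (M.image Prod.snd) y z → 0 < (derivative p₂).eval z)
    (hroot : ∀ r s, p₁.eval r = 0 → p₂.eval s = 0 → MRel M r s →
      (r < x ↔ s < y) ∧ (x < r ↔ y < s)) : SS (p₁.eval x) (p₂.eval y) := by
  have A := match_noncross h₁ h₂ M hM p₁ p₂ n₁ n₂ hs x y hr hx hy d₁ d₂ hroot
  have e1 : (M.image Prod.swap).image Prod.fst = M.image Prod.snd := by
    rw [Finset.image_image]; rfl
  have e2 : (M.image Prod.swap).image Prod.snd = M.image Prod.fst := by
    rw [Finset.image_image]; rfl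
  have B := match_noncross h₂ h₁ (M.image Prod.swap) (by
      intro p hp
      obtain ⟨q, hq, rfl⟩ := Finset.mem_image.1 hp
      exact (hM q hq).swap) p₂ p₁ n₂ n₁ (by
      intro p hp
      obtain ⟨q, hq, rfl⟩ := Finset.mem_image.1 hp
      exact (hs q hq).symm) y x hr.swap (by rw [e1]; exact hy) (by rw [e2]; exact hx)
      (by rw [e1]; exact d₂) (by rw [e2]; exact d₁) (by
      intro r s h1 h2 h3
      have := hroot s r h2 h1 h3.unswap
      exact ⟨this.1.symm, this.2.symm⟩)
  refine ⟨⟨fun h => ?_, fun h => ?_⟩, ⟨fun h => ?_, fun h => ?_⟩⟩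
  · by_contra hc
    exact h.ne' (A h.le (not_lt.1 hc)).1
  · by_contra hc
    exact h.ne' (B h.le (not_lt.1 hc)).1
  · by_contra hc
    exact h.ne (B (not_lt.1 hc) h.le).2
  · by_contra hc
    exact h.ne (A (not_lt.1 hc) h.le).2

/-- On gaps the derivative does not vanish. -/
theorem match_der_ne (M : Finset (R₁ × R₂)) (hM : ∀ p ∈ M, MRel M p.1 p.2)
    (p₁ : R₁[X]) (p₂ : R₂[X]) (n₁ : 1 ≤ p₁.natDegree)
    (hD : ∀ x y, MRel M x y → SS ((derivative p₁).eval x) ((derivative p₂).eval y))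
    (x : R₁) : x ∉ M.image Prod.fst → (derivative p₁).eval x ≠ 0 := by
  intro hx h0
  obtain ⟨y, hy⟩ := MRel.exists hM x
  obtain ⟨m, hm1, hm2⟩ := Order.exists_between_finsets {x}
    ((M.image Prod.fst).filter (fun s => x < s)) (by
      intro a ha b hb
      rw [Finset.mem_singleton] at ha
      rw [ha]
      exact (Finset.mem_filter.1 hb).2)
  have hxm : x < m := hm1 x (Finset.mem_singleton_self x)
  have hall : ∀ z ∈ Set.Ioo x m, (derivative p₁).IsRoot z := by
    rintro z ⟨hz1, hz2⟩
    have : MRel M z y := hy.gap_left (by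
      intro s hs
      have hne : s ≠ x := fun h => hx (h ▸ hs)
      have key : x < s → m < s := fun h => hm2 s (Finset.mem_filter.2 ⟨hs, h⟩)
      refine ⟨⟨fun h => h.trans hz1, fun h => ?_⟩, fun h => hz2.trans (key h),
        fun h => hz1.trans h⟩
      by_contra hc
      exact absurd (key (lt_of_le_of_ne (not_lt.1 hc) hne.symm)) (not_lt.2 (h.trans hz2).le))
    exact (hD z y this).zero_iff.2 ((hD x y hy).zero_iff.1 h0)
  have hinf : (Set.Ioo x m).Infinite := Set.Ioo_infinite hxm
  have hz := Polynomial.eq_zero_of_infinite_isRoot (derivative p₁) (hinf.mono hall)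
  have := derivative_eq_zero.1 hz
  omega

theorem match_sign (h₁ : PIVT R₁) (h₂ : PIVT R₂) (M : Finset (R₁ × R₂))
    (hM : ∀ p ∈ M, MRel M p.1 p.2) (p₁ : R₁[X]) (p₂ : R₂[X])
    (n₁ : 1 ≤ p₁.natDegree) (n₂ : 1 ≤ p₂.natDegree)
    (hs : ∀ q ∈ M, SS (p₁.eval q.1) (p₂.eval q.2))
    (hD : ∀ x y, MRel M x y → SS ((derivative p₁).eval x) ((derivative p₂).eval y))
    (x : R₁) (y : R₂) (hr : MRel M x y)
    (hroot : ∀ r s, p₁.eval r = 0 → p₂.eval s = 0 → MRel M r s →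
      (r < x ↔ s < y) ∧ (x < r ↔ y < s)) : SS (p₁.eval x) (p₂.eval y) := by
  by_cases hx : x ∈ M.image Prod.fst
  · obtain ⟨q, hq, rfl⟩ := Finset.mem_image.1 hx
    rw [← (hr.eq_iff hq).1 rfl]
    exact hs q hq
  have hy : y ∉ M.image Prod.snd := by
    intro hy
    obtain ⟨q, hq, rfl⟩ := Finset.mem_image.1 hy
    apply hx
    rw [← (hr.eq_iff hq).2 rfl]
    exact Finset.mem_image_of_mem _ hq
  have hne := match_der_ne M hM p₁ p₂ n₁ hD x hx
  have hd0 := hD x y hr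
  rcases lt_or_gt_of_ne hne with h | h
  · apply SS.of_neg
    rw [← eval_neg, ← eval_neg]
    have hy0 := hd0.2.1 h
    apply match_pos h₁ h₂ M hM (-p₁) (-p₂) (by simpa using n₁) (by simpa using n₂)
      (fun q hq => by simpa using (hs q hq).neg) x y hr hx hy
    · intro z hz
      have := (hD z y (hr.gap_left hz)).2.2 hy0
      simpa using this
    · intro z hz
      have := (hD x z (hr.gap_right hz)).2.1 h
      simpa using this
    · intro r s h1 h2 h3
      exact hroot r s (by simpa using h1) (by simpa using h2) h3
  · have hy0 := hd0.1.1 h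
    exact match_pos h₁ h₂ M hM p₁ p₂ n₁ n₂ hs x y hr hx hy
      (fun z hz => (hD z y (hr.gap_left hz)).1.2 hy0)
      (fun z hz => (hD x z (hr.gap_right hz)).1.1 h) hroot

/-- Two distinct roots in `R₁` are separated by matched points. -/
theorem match_sep (h₁ : PIVT R₁) (M : Finset (R₁ × R₂))
    (hM : ∀ p ∈ M, MRel M p.1 p.2) (p₁ : R₁[X]) (p₂ : R₂[X])
    (n₁ : 1 ≤ p₁.natDegree)
    (hD : ∀ x y, MRel M x y → SS ((derivative p₁).eval x) ((derivative p₂).eval y))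
    (r s : R₁) (r' s' : R₂) (hr : p₁.eval r = 0) (hs : p₁.eval s = 0)
    (hrr : MRel M r r') (hss : MRel M s s') (h : r < s) : r' < s' := by
  obtain ⟨c, hc1, hc2, hc3⟩ := h₁.rolle p₁ r s h hr hs
  have hc : c ∈ M.image Prod.fst := by
    by_contra hc
    exact match_der_ne M hM p₁ p₂ n₁ hD c hc hc3
  obtain ⟨q, hq, rfl⟩ := Finset.mem_image.1 hc
  exact ((hrr q hq).2.1 hc1).trans ((hss q hq).1.1 hc2)

theorem match_step (h₁ : PIVT R₁) (h₂ : PIVT R₂) (M : Finset (R₁ × R₂))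
    (hM : ∀ p ∈ M, MRel M p.1 p.2) (p₁ : R₁[X]) (p₂ : R₂[X])
    (n₁ : 1 ≤ p₁.natDegree) (n₂ : 1 ≤ p₂.natDegree)
    (hs : ∀ q ∈ M, SS (p₁.eval q.1) (p₂.eval q.2))
    (hD : ∀ x y, MRel M x y → SS ((derivative p₁).eval x) ((derivative p₂).eval y)) :
    ∃ M' : Finset (R₁ × R₂), M ⊆ M' ∧ (∀ p ∈ M', MRel M' p.1 p.2) ∧
      (∀ p ∈ M', p ∈ M ∨ p₁.eval p.1 = 0) ∧
      (∀ x y, MRel M' x y → SS (p₁.eval x) (p₂.eval y)) := by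
  classical
  have hp₁ : p₁ ≠ 0 := by rintro rfl; simp at n₁
  have hp₂ : p₂ ≠ 0 := by rintro rfl; simp at n₂
  let N := (p₁.roots.toFinset ×ˢ p₂.roots.toFinset).filter (fun q => MRel M q.1 q.2)
  have hN : ∀ q, q ∈ N ↔ p₁.eval q.1 = 0 ∧ p₂.eval q.2 = 0 ∧ MRel M q.1 q.2 := by
    intro q
    simp [N, hp₁, hp₂, and_assoc]
  have hDs : ∀ x y, MRel (M.image Prod.swap) x y →
      SS ((derivative p₂).eval x) ((derivative p₁).eval y) := fun x y h => (hD y x h.unswap).symm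
  have hMs : ∀ p ∈ M.image Prod.swap, MRel (M.image Prod.swap) p.1 p.2 := by
    intro p hp
    obtain ⟨q, hq, rfl⟩ := Finset.mem_image.1 hp
    exact (hM q hq).swap
  refine ⟨M ∪ N, Finset.subset_union_left, ?_, ?_, ?_⟩
  · have hrel : ∀ p ∈ M ∪ N, MRel M p.1 p.2 := by
      intro p hp
      rcases Finset.mem_union.1 hp with hp | hp
      · exact hM p hp
      · exact ((hN p).1 hp).2.2
    intro p hp q hq
    rcases Finset.mem_union.1 hq with hqM | hqN
    · exact hrel p hp q hqM
    rcases Finset.mem_union.1 hp with hpM | hpN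
    · have := hrel q hq p hpM
      exact ⟨this.2, this.1⟩
    obtain ⟨a1, a2, a3⟩ := (hN p).1 hpN
    obtain ⟨b1, b2, b3⟩ := (hN q).1 hqN
    refine ⟨⟨fun h => ?_, fun h => ?_⟩, ⟨fun h => ?_, fun h => ?_⟩⟩
    · exact match_sep h₁ M hM p₁ p₂ n₁ hD q.1 p.1 q.2 p.2 b1 a1 b3 a3 h
    · exact match_sep h₂ _ hMs p₂ p₁ n₂ hDs q.2 p.2 q.1 p.1 b2 a2 b3.swap a3.swap h
    · exact match_sep h₁ M hM p₁ p₂ n₁ hD p.1 q.1 p.2 q.2 a1 b1 a3 b3 h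
    · exact match_sep h₂ _ hMs p₂ p₁ n₂ hDs p.2 q.2 p.1 q.1 a2 b2 a3.swap b3.swap h
  · intro p hp
    rcases Finset.mem_union.1 hp with hp | hp
    · exact Or.inl hp
    · exact Or.inr ((hN p).1 hp).1
  · intro x y hxy
    apply match_sign h₁ h₂ M hM p₁ p₂ n₁ n₂ hs hD x y
      (fun p hp => hxy p (Finset.mem_union_left _ hp))
    intro r s h1 h2 h3
    exact hxy (r, s) (Finset.mem_union_right _ ((hN (r, s)).2 ⟨h1, h2, h3⟩))

end matching

/-! ## Elimination of one variable -/

section elim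
open Polynomial

theorem exists_prem {A : Type*} [CommRing A] (g : A[X]) (hg : 1 ≤ g.natDegree) (f : A[X]) :
    ∃ (q r : A[X]) (e : ℕ), C (g.leadingCoeff ^ (2 * e)) * f = q * g + r ∧
      r.natDegree < g.natDegree := by
  induction hn : f.natDegree using Nat.strong_induction_on generalizing f with
  | _ n ih =>
    by_cases hlt : f.natDegree < g.natDegree
    · exact ⟨0, f, 0, by simp, hlt⟩
    push Not at hlt
    set k := f.natDegree - g.natDegree with hk
    let f1 : A[X] := C g.leadingCoeff * (C g.leadingCoeff * f - C f.leadingCoeff * X ^ k * g)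
    have hle : f1.natDegree ≤ n := by
      refine (natDegree_C_mul_le _ _).trans ?_
      refine (natDegree_sub_le _ _).trans (max_le ?_ ?_)
      · exact (natDegree_C_mul_le _ _).trans hn.le
      · rw [mul_assoc]
        refine (natDegree_C_mul_le _ _).trans ?_
        refine natDegree_mul_le.trans ?_
        have := natDegree_X_pow_le (R := A) k
        omega
    have hc : f1.coeff n = 0 := by
      have h1 : (X ^ k * g).coeff n = g.leadingCoeff := by
        have : n = g.natDegree + k := by omega
        rw [this, coeff_X_pow_mul]; rfl
      simp only [f1, coeff_C_mul, coeff_sub, mul_assoc, h1]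
      rw [← hn, coeff_natDegree]
      ring
    have hlt1 : f1.natDegree < n := by
      refine lt_of_le_of_ne hle fun h => ?_
      have : f1 = 0 := by
        rw [← leadingCoeff_eq_zero, leadingCoeff, h, hc]
      rw [this] at h
      simp at h
      omega
    obtain ⟨q, r, e, h1, h2⟩ := ih _ hlt1 f1 rfl
    refine ⟨q + C (g.leadingCoeff ^ (2 * e)) * C g.leadingCoeff * C f.leadingCoeff * X ^ k, r,
      e + 1, ?_, h2⟩
    have : C (g.leadingCoeff ^ (2 * (e + 1))) * f = C (g.leadingCoeff ^ (2 * e)) * f1 +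
        C (g.leadingCoeff ^ (2 * e)) * C g.leadingCoeff * C f.leadingCoeff * X ^ k * g := by
      simp only [f1, map_pow]
      ring
    rw [this, h1]
    ring

open Classical in
/-- Pseudo-remainder (with an even power of the leading coefficient). -/
noncomputable def prem {A : Type*} [CommRing A] (f g : A[X]) : A[X] :=
  if hg : 1 ≤ g.natDegree then (exists_prem g hg f).choose_spec.choose else 0

theorem prem_spec {A : Type*} [CommRing A] (f g : A[X]) (hg : 1 ≤ g.natDegree) :
    ∃ (q : A[X]) (e : ℕ), C (g.leadingCoeff ^ (2 * e)) * f = q * g + prem f g := by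
  refine ⟨(exists_prem g hg f).choose, (exists_prem g hg f).choose_spec.choose_spec.choose, ?_⟩
  rw [prem, dif_pos hg]
  exact (exists_prem g hg f).choose_spec.choose_spec.choose_spec.1

theorem prem_natDegree {A : Type*} [CommRing A] (f g : A[X]) (hg : 1 ≤ g.natDegree) :
    (prem f g).natDegree < g.natDegree := by
  rw [prem, dif_pos hg]
  exact (exists_prem g hg f).choose_spec.choose_spec.choose_spec.2

/-- Closedness (above degree `d`) under derivative, truncation and pseudo-remainders. -/
def ClosedFam {A : Type*} [CommRing A] (d : ℕ) (S : Finset A[X]) : Prop :=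
  ∀ f ∈ S, d ≤ f.natDegree → derivative f ∈ S ∧ f.eraseLead ∈ S ∧
    ∀ g ∈ S, d ≤ g.natDegree → g.natDegree ≤ f.natDegree → prem f g ∈ S

theorem exists_closedFam {A : Type*} [CommRing A] (S : Finset A[X]) :
    ∃ T, S ⊆ T ∧ ClosedFam 1 T := by
  classical
  have key : ∀ j D : ℕ, (∀ f ∈ S, f.natDegree ≤ D) → j ≤ D →
      ∃ T, S ⊆ T ∧ ClosedFam (D + 1 - j) T := by
    intro j D hD hj
    induction j with
    | zero =>
      refine ⟨S, subset_rfl, fun f hf h => ?_⟩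
      have := hD f hf
      omega
    | succ j ih =>
      obtain ⟨T, hST, hT⟩ := ih (by omega)
      set d := D + 1 - (j + 1) with hd
      have hd1 : 1 ≤ d := by omega
      have hd2 : D + 1 - j = d + 1 := by omega
      rw [hd2] at hT
      let W := T.filter (fun f => d ≤ f.natDegree)
      let P := (W ×ˢ W).filter (fun q => q.2.natDegree ≤ q.1.natDegree)
      let T' := T ∪ W.image (fun f => derivative f) ∪ W.image (fun f => f.eraseLead) ∪
        P.image (fun q => prem q.1 q.2)
      have hnew : ∀ f ∈ T', d ≤ f.natDegree → f ∈ T := by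
        intro f hf hdf
        simp only [T', Finset.mem_union, Finset.mem_image] at hf
        rcases hf with ((hf | ⟨g, hg, rfl⟩) | ⟨g, hg, rfl⟩) | ⟨q, hq, rfl⟩
        · exact hf
        · obtain ⟨hg1, hg2⟩ := Finset.mem_filter.1 hg
          have := natDegree_derivative_lt (p := g) (by omega)
          exact (hT g hg1 (by omega)).1
        · obtain ⟨hg1, hg2⟩ := Finset.mem_filter.1 hg
          have := eraseLead_natDegree_le g
          exact (hT g hg1 (by omega)).2.1
        · obtain ⟨hq1, hq2⟩ := Finset.mem_filter.1 hq
          obtain ⟨hq3, hq4⟩ := Finset.mem_product.1 hq1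
          obtain ⟨a1, a2⟩ := Finset.mem_filter.1 hq3
          obtain ⟨b1, b2⟩ := Finset.mem_filter.1 hq4
          have := prem_natDegree q.1 q.2 (by omega)
          exact (hT q.1 a1 (by omega)).2.2 q.2 b1 (by omega) hq2
      refine ⟨T', fun f hf => ?_, fun f hf hdf => ?_⟩
      · simp only [T', Finset.mem_union]
        exact Or.inl (Or.inl (Or.inl (hST hf)))
      · have hfW : f ∈ W := Finset.mem_filter.2 ⟨hnew f hf hdf, hdf⟩
        simp only [T', Finset.mem_union]
        refine ⟨Or.inl (Or.inl (Or.inr (Finset.mem_image_of_mem _ hfW))),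
          Or.inl (Or.inr (Finset.mem_image_of_mem (fun f : A[X] => f.eraseLead) hfW)),
          fun g hg hdg hgf => Or.inr ?_⟩
        have hgW : g ∈ W := Finset.mem_filter.2 ⟨hnew g (by simpa only [T', Finset.mem_union] using hg) hdg, hdg⟩
        exact Finset.mem_image.2 ⟨(f, g), Finset.mem_filter.2
          ⟨Finset.mem_product.2 ⟨hfW, hgW⟩, hgf⟩, rfl⟩
  obtain ⟨T, h1, h2⟩ := key (S.sup natDegree) (S.sup natDegree)
    (fun f hf => Finset.le_sup (f := natDegree) hf) le_rfl
  refine ⟨T, h1, ?_⟩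
  have : S.sup natDegree + 1 - S.sup natDegree = 1 := by omega
  rwa [this] at h2

variable {R₁ R₂ : Type*} [Field R₁] [LinearOrder R₁] [IsStrictOrderedRing R₁]
  [Field R₂] [LinearOrder R₂] [IsStrictOrderedRing R₂] {A : Type*} [CommRing A]

theorem eval_map_prem (φ : A →+* R₁) (f g : A[X]) (q : A[X]) (e : ℕ)
    (h : C (g.leadingCoeff ^ (2 * e)) * f = q * g + prem f g) (x : R₁)
    (hx : (g.map φ).eval x = 0) :
    (φ g.leadingCoeff ^ e) ^ 2 * (f.map φ).eval x = ((prem f g).map φ).eval x := by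
  have := congrArg (fun p => (p.map φ).eval x) h
  simp only [Polynomial.map_mul, Polynomial.map_add, map_C, eval_mul, eval_add, eval_C, hx,
    mul_zero, zero_add, map_pow, Polynomial.map_pow, eval_pow] at this
  rw [← this]
  ring

theorem SS.of_sq_mul {u c : R₁} {v d : R₂} (hc : c ≠ 0) (hd : d ≠ 0)
    (h : SS (c ^ 2 * u) (d ^ 2 * v)) : SS u v := by
  have h1 : 0 < c ^ 2 := by positivity
  have h2 : 0 < d ^ 2 := by positivity
  obtain ⟨h3, h4⟩ := h
  rw [mul_pos_iff_of_pos_left h1, mul_pos_iff_of_pos_left h2] at h3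
  rw [← neg_pos, ← mul_neg, mul_pos_iff_of_pos_left h1, neg_pos, ← neg_pos (a := d ^ 2 * v),
    ← mul_neg, mul_pos_iff_of_pos_left h2, neg_pos] at h4
  exact ⟨h3, h4⟩

theorem exists_match (h₁ : PIVT R₁) (h₂ : PIVT R₂) (φ₁ : A →+* R₁) (φ₂ : A →+* R₂)
    (S : Finset A[X]) : ClosedFam 1 S →
    (∀ f ∈ S, SS (φ₁ f.leadingCoeff) (φ₂ f.leadingCoeff)) →
    ∃ M : Finset (R₁ × R₂), (∀ p ∈ M, MRel M p.1 p.2) ∧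
      (∀ f ∈ S, ∀ x y, MRel M x y → SS ((f.map φ₁).eval x) ((f.map φ₂).eval y)) ∧
      (∀ p ∈ M, ∃ g ∈ S, 1 ≤ g.natDegree ∧ φ₁ g.leadingCoeff ≠ 0 ∧ (g.map φ₁).eval p.1 = 0) := by
  classical
  induction S using Finset.induction_on_max_value (fun f : A[X] => f.natDegree) with
  | empty => exact fun _ _ => ⟨∅, by simp, by simp, by simp⟩
  | insert f S hfS hmax ih =>
    intro hcl hlc
    have hlow : ∀ g ∈ insert f S, g.natDegree < f.natDegree → g ∈ S := by
      intro g hg hlt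
      rcases Finset.mem_insert.1 hg with rfl | hg
      · exact absurd hlt (lt_irrefl _)
      · exact hg
    have hclS : ClosedFam 1 S := by
      intro g hg hdg
      have hgf := hmax g hg
      obtain ⟨a1, a2, a3⟩ := hcl g (Finset.mem_insert_of_mem hg) hdg
      refine ⟨hlow _ a1 ?_, hlow _ a2 ?_, fun k hk hdk hkg => hlow _
        (a3 k (Finset.mem_insert_of_mem hk) hdk hkg) ?_⟩
      · have := natDegree_derivative_lt (p := g) (by omega)
        omega
      · have := eraseLead_natDegree_le g
        omega
      · have := prem_natDegree g k hdk
        omega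
    obtain ⟨M, hM, hS, hR⟩ := ih hclS (fun g hg => hlc g (Finset.mem_insert_of_mem hg))
    have easy : (∀ x y, MRel M x y → SS ((f.map φ₁).eval x) ((f.map φ₂).eval y)) →
        ∃ M : Finset (R₁ × R₂), (∀ p ∈ M, MRel M p.1 p.2) ∧
      (∀ k ∈ insert f S, ∀ x y, MRel M x y → SS ((k.map φ₁).eval x) ((k.map φ₂).eval y)) ∧
      (∀ p ∈ M, ∃ g ∈ insert f S,
        1 ≤ g.natDegree ∧ φ₁ g.leadingCoeff ≠ 0 ∧ (g.map φ₁).eval p.1 = 0) := by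
      intro hf
      refine ⟨M, hM, fun g hg => ?_, fun p hp => ?_⟩
      · rcases Finset.mem_insert.1 hg with rfl | hg
        · exact hf
        · exact hS g hg
      · obtain ⟨g, hg, h⟩ := hR p hp
        exact ⟨g, Finset.mem_insert_of_mem hg, h⟩
    have hlf := hlc f (Finset.mem_insert_self _ _)
    by_cases hdeg : 1 ≤ f.natDegree
    swap
    · apply easy
      intro x y _
      have hf : f = C (f.coeff 0) := eq_C_of_natDegree_eq_zero (by omega)
      have hl : f.leadingCoeff = f.coeff 0 := by rw [leadingCoeff]; congr 1; omega
      rw [hl] at hlf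
      rw [hf]
      simpa using hlf
    obtain ⟨c1, c2, c3⟩ := hcl f (Finset.mem_insert_self _ _) hdeg
    by_cases h0 : φ₁ f.leadingCoeff = 0
    · apply easy
      intro x y hxy
      have h0' : φ₂ f.leadingCoeff = 0 := hlf.zero_iff.1 h0
      have he : f.eraseLead ∈ S := hlow _ c2 (by have := eraseLead_natDegree_le f; omega)
      have e1 : f.map φ₁ = f.eraseLead.map φ₁ := by
        conv_lhs => rw [← eraseLead_add_C_mul_X_pow f]
        simp only [Polynomial.map_add, Polynomial.map_mul, map_C, h0, map_zero, zero_mul, add_zero]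
      have e2 : f.map φ₂ = f.eraseLead.map φ₂ := by
        conv_lhs => rw [← eraseLead_add_C_mul_X_pow f]
        simp only [Polynomial.map_add, Polynomial.map_mul, map_C, h0', map_zero, zero_mul,
          add_zero]
      rw [e1, e2]
      exact hS _ he x y hxy
    have h0' : φ₂ f.leadingCoeff ≠ 0 := fun h => h0 (hlf.zero_iff.2 h)
    have n₁ : (f.map φ₁).natDegree = f.natDegree := natDegree_map_of_leadingCoeff_ne_zero φ₁ h0
    have n₂ : (f.map φ₂).natDegree = f.natDegree := natDegree_map_of_leadingCoeff_ne_zero φ₂ h0'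
    have hd : derivative f ∈ S := hlow _ c1 (natDegree_derivative_lt (by omega))
    obtain ⟨M', hMM, hM', hnew, hsg⟩ := match_step h₁ h₂ M hM (f.map φ₁) (f.map φ₂)
      (by omega) (by omega) (by
        intro p hp
        obtain ⟨g, hg, hdg, hgl, hgz⟩ := hR p hp
        have hgl' : φ₂ g.leadingCoeff ≠ 0 := fun h =>
          hgl ((hlc g (Finset.mem_insert_of_mem hg)).zero_iff.2 h)
        have hgz' : (g.map φ₂).eval p.2 = 0 := (hS g hg p.1 p.2 (hM p hp)).zero_iff.1 hgz
        obtain ⟨q, e, hq⟩ := prem_spec f g hdg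
        have hpr : prem f g ∈ S := hlow _
          (c3 g (Finset.mem_insert_of_mem hg) hdg (hmax g hg)) (by
            have := prem_natDegree f g hdg
            have := hmax g hg
            omega)
        have hss := hS _ hpr p.1 p.2 (hM p hp)
        rw [← eval_map_prem φ₁ f g q e hq p.1 hgz, ← eval_map_prem φ₂ f g q e hq p.2 hgz'] at hss
        exact hss.of_sq_mul (pow_ne_zero _ hgl) (pow_ne_zero _ hgl'))
      (by
        intro x y hxy
        rw [derivative_map, derivative_map]
        exact hS _ hd x y hxy)
    refine ⟨M', hM', fun g hg x y hxy => ?_, fun p hp => ?_⟩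
    · rcases Finset.mem_insert.1 hg with rfl | hg
      · exact hsg x y hxy
      · exact hS g hg x y (fun p hp => hxy p (hMM hp))
    · rcases hnew p hp with hp | hp
      · obtain ⟨g, hg, h⟩ := hR p hp
        exact ⟨g, Finset.mem_insert_of_mem hg, h⟩
      · exact ⟨f, Finset.mem_insert_self _ _, hdeg, h0, hp⟩

theorem elim_var (S : Finset A[X]) : ∃ G : Finset A,
    ∀ (_ : PIVT R₁) (_ : PIVT R₂) (φ₁ : A →+* R₁) (φ₂ : A →+* R₂),
      (∀ g ∈ G, SS (φ₁ g) (φ₂ g)) → ∀ x : R₁, ∃ y : R₂, ∀ f ∈ S,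
        SS ((f.map φ₁).eval x) ((f.map φ₂).eval y) := by
  classical
  obtain ⟨T, hST, hT⟩ := exists_closedFam S
  refine ⟨T.image leadingCoeff, fun h₁ h₂ φ₁ φ₂ hG x => ?_⟩
  obtain ⟨M, hM, hS, -⟩ := exists_match h₁ h₂ φ₁ φ₂ T hT
    (fun f hf => hG _ (Finset.mem_image_of_mem _ hf))
  obtain ⟨y, hy⟩ := MRel.exists hM x
  exact ⟨y, fun f hf => hS f (hST hf) x y hy⟩

theorem eval_finSucc {R : Type*} [CommRing R] {n : ℕ} (c : Fin n → R) (z : R)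
    (f : MvPolynomial (Fin (n + 1)) ℤ) :
    ((MvPolynomial.finSuccEquiv ℤ n f).map (MvPolynomial.aeval c).toRingHom).eval z =
      MvPolynomial.aeval (Fin.cons z c : Fin (n + 1) → R) f := by
  induction f using MvPolynomial.induction_on with
  | C z => simp
  | add p q hp hq => simp only [map_add, Polynomial.map_add, eval_add, hp, hq]
  | mul_X p i hp =>
    simp only [map_mul, Polynomial.map_mul, eval_mul, hp]
    congr 1
    refine Fin.cases ?_ (fun j => ?_) i
    · simp [MvPolynomial.finSuccEquiv_X_zero]
    · simp [MvPolynomial.finSuccEquiv_X_succ]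

theorem transfer_fin (h₁ : PIVT R₁) (h₂ : PIVT R₂) (n : ℕ) (S : Finset (MvPolynomial (Fin n) ℤ))
    (a : Fin n → R₁) : ∃ b : Fin n → R₂, ∀ f ∈ S,
      SS (MvPolynomial.aeval a f) (MvPolynomial.aeval b f) := by
  classical
  induction n with
  | zero =>
    refine ⟨Fin.elim0, fun f _ => ?_⟩
    obtain ⟨z, rfl⟩ := MvPolynomial.C_surjective (Fin 0) f
    simp [SS]
  | succ n ih =>
    obtain ⟨G, hG⟩ := elim_var (R₁ := R₁) (R₂ := R₂) (S.image (MvPolynomial.finSuccEquiv ℤ n))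
    obtain ⟨b, hb⟩ := ih G (fun i => a i.succ)
    obtain ⟨y, hy⟩ := hG h₁ h₂
      (MvPolynomial.aeval (fun i => a i.succ) : MvPolynomial (Fin n) ℤ →ₐ[ℤ] R₁).toRingHom
      (MvPolynomial.aeval b : MvPolynomial (Fin n) ℤ →ₐ[ℤ] R₂).toRingHom
      (fun g hg => hb g hg) (a 0)
    refine ⟨Fin.cons y b, fun f hf => ?_⟩
    have e : (Fin.cons (a 0) (fun i => a i.succ) : Fin (n + 1) → R₁) = a := Fin.cons_self_tail a
    have k1 := eval_finSucc b y f
    have k2 := eval_finSucc (fun i => a i.succ) (a 0) f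
    rw [e] at k2
    rw [← k1, ← k2]
    exact hy (MvPolynomial.finSuccEquiv ℤ n f) (Finset.mem_image.2 ⟨f, hf, rfl⟩)

end elim

theorem PIVT_real : PIVT ℝ := by
  intro p a b hab h
  have hc : ContinuousOn (fun x => p.eval x) (Set.Icc a b) := p.continuous.continuousOn
  rcases mul_neg_iff.1 h with ⟨h1, h2⟩ | ⟨h1, h2⟩
  · obtain ⟨r, hr, h0⟩ := intermediate_value_Ioo' hab.le hc ⟨h2, h1⟩
    exact ⟨r, hr.1, hr.2, h0⟩
  · obtain ⟨r, hr, h0⟩ := intermediate_value_Ioo hab.le hc ⟨h1, h2⟩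
    exact ⟨r, hr.1, hr.2, h0⟩

/-! ## The ring of differences -/

section diff

/-- The congruence defining the ring of differences of an additively cancellative semiring. -/
def diffCon (L : Type) [CommSemiring L] (hA : addCanc L) : RingCon (QuadraticAlgebra L 1 0) where
  r x y := x.re + y.im = y.re + x.im
  iseqv := ⟨fun _ => rfl, fun h => h.symm, fun {x y z} h1 h2 => by
    apply hA (y.re + y.im)
    calc y.re + y.im + (x.re + z.im) = (x.re + y.im) + (y.re + z.im) := by ring
      _ = (y.re + x.im) + (z.re + y.im) := by rw [h1, h2]
      _ = y.re + y.im + (z.re + x.im) := by ring⟩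
  add' {w x y z} h1 h2 := by
    simp only [QuadraticAlgebra.re_add, QuadraticAlgebra.im_add]
    calc w.re + y.re + (x.im + z.im) = (w.re + x.im) + (y.re + z.im) := by ring
      _ = (x.re + w.im) + (z.re + y.im) := by rw [h1, h2]
      _ = x.re + z.re + (w.im + y.im) := by ring
  mul' {w x y z} h1 h2 := by
    simp only [QuadraticAlgebra.re_mul, QuadraticAlgebra.im_mul]
    have key : (w * y).re + (x * y).im = (x * y).re + (w * y).im := by
      simp only [QuadraticAlgebra.re_mul, QuadraticAlgebra.im_mul]
      calc w.re * y.re + 1 * w.im * y.im + (x.re * y.im + x.im * y.re + 0 * x.im * y.im) =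
          (w.re + x.im) * y.re + (x.re + w.im) * y.im := by ring
        _ = (x.re + w.im) * y.re + (w.re + x.im) * y.im := by rw [h1]
        _ = _ := by ring
    have key2 : (x * y).re + (x * z).im = (x * z).re + (x * y).im := by
      simp only [QuadraticAlgebra.re_mul, QuadraticAlgebra.im_mul]
      calc x.re * y.re + 1 * x.im * y.im + (x.re * z.im + x.im * z.re + 0 * x.im * z.im) =
          x.re * (y.re + z.im) + x.im * (z.re + y.im) := by ring
        _ = x.re * (z.re + y.im) + x.im * (y.re + z.im) := by rw [h2]
        _ = _ := by ring
    have h3 : (w * y).re + (x * z).im = (x * z).re + (w * y).im := by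
      apply hA ((x * y).re + (x * y).im)
      calc (x * y).re + (x * y).im + ((w * y).re + (x * z).im) =
        ((w * y).re + (x * y).im) + ((x * y).re + (x * z).im) := by ring
        _ = ((x * y).re + (w * y).im) + ((x * z).re + (x * y).im) := by rw [key, key2]
        _ = _ := by ring
    simpa only [QuadraticAlgebra.re_mul, QuadraticAlgebra.im_mul] using h3

theorem exists_diffRing (L : Type) [CommSemiring L] (hT : natTotOrd L) (hA : addCanc L)
    (hM : mulCanc L) (h01 : (0 : L) ≠ 1) :
    ∃ (D : Type) (_ : CommRing D) (_ : IsDomain D) (i : L →+* D), Function.Injective i ∧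
      ∀ d, ∃ l, d = i l ∨ d = -i l := by
  let c := diffCon L hA
  have hc : ∀ x y : QuadraticAlgebra L 1 0, (x : c.Quotient) = y ↔ x.re + y.im = y.re + x.im :=
    fun x y => RingCon.eq c
  let ng : c.Quotient → c.Quotient := Quotient.map' (fun x => ⟨x.im, x.re⟩) (by
    intro x y h
    have h : x.re + y.im = y.re + x.im := h
    change x.im + y.re = y.im + x.re
    rw [add_comm, ← h, add_comm])
  have hng : ∀ x : QuadraticAlgebra L 1 0, ng (x : c.Quotient) =
    ((⟨x.im, x.re⟩ : QuadraticAlgebra L 1 0) : c.Quotient) := fun x => rfl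
  let _ : CommRing c.Quotient :=
    { (inferInstance : CommSemiring c.Quotient) with
      neg := ng
      zsmul := @zsmulRec _ _ _ ⟨ng⟩ (@nsmulRec _ _ _)
      neg_add_cancel := by
        intro a
        induction a using Quotient.inductionOn' with
        | h x =>
          change ng (x : c.Quotient) + (x : c.Quotient) = 0
          rw [hng, ← RingCon.coe_add, ← RingCon.coe_zero, hc]
          simp [add_comm] }
  let i : L →+* c.Quotient :=
    { toFun := fun l => ((⟨l, 0⟩ : QuadraticAlgebra L 1 0) : c.Quotient)
      map_one' := rfl
      map_zero' := rfl
      map_add' := fun x y => by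
        rw [← RingCon.coe_add, hc]; simp
      map_mul' := fun x y => by
        rw [← RingCon.coe_mul, hc]; simp }
  have hi : ∀ l, i l = ((⟨l, 0⟩ : QuadraticAlgebra L 1 0) : c.Quotient) := fun _ => rfl
  have hni : ∀ l, -i l = ((⟨0, l⟩ : QuadraticAlgebra L 1 0) : c.Quotient) := fun _ => rfl
  have hinj : Function.Injective i := by
    intro x y h
    rw [hi, hi, hc] at h
    simpa using h
  have hsurj : ∀ d : c.Quotient, ∃ l, d = i l ∨ d = -i l := by
    intro d
    induction d using Quotient.inductionOn' with
    | h x =>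
      rcases hT.2 x.re x.im with ⟨l, hl⟩ | ⟨l, hl⟩
      · refine ⟨l, Or.inr ?_⟩
        rw [hni]
        refine (hc _ _).2 ?_
        simp [hl]
      · refine ⟨l, Or.inl ?_⟩
        rw [hi]
        refine (hc _ _).2 ?_
        simp [← hl, add_comm]
  have : Nontrivial c.Quotient := ⟨i 0, i 1, fun h => h01 (hinj h)⟩
  have : NoZeroDivisors c.Quotient := by
    have key : ∀ a b, i a * i b = 0 → i a = 0 ∨ i b = 0 := by
      intro a b h
      rw [← map_mul, ← map_zero i] at h
      have h := hinj h
      by_cases ha : a = 0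
      · left; rw [ha, map_zero]
      · right
        rw [hM a b 0 ha (by rw [h, mul_zero]), map_zero]
    refine ⟨fun {a b} h => ?_⟩
    obtain ⟨x, rfl | rfl⟩ := hsurj a <;> obtain ⟨y, rfl | rfl⟩ := hsurj b <;>
      simpa using key x y (by simpa using h)
  exact ⟨c.Quotient, inferInstance, NoZeroDivisors.to_isDomain _, i, hinj, hsurj⟩

end diff

/-! ## Real closed extensions -/

section rcf
open Polynomial

variable {Ω : Type} [Field Ω] (P : Subsemiring Ω)

/-- The sums of squares of elements of `E`, weighted by elements of `P`. -/
def TT (E : Subfield Ω) : AddSubmonoid Ω :=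
  AddSubmonoid.closure {x | ∃ p ∈ P, ∃ e ∈ E, x = p * e ^ 2}

variable {P}

theorem TT.gen {E : Subfield Ω} {p e : Ω} (hp : p ∈ P) (he : e ∈ E) : p * e ^ 2 ∈ TT P E :=
  AddSubmonoid.subset_closure ⟨p, hp, e, he, rfl⟩

theorem TT.sq {E : Subfield Ω} {e : Ω} (he : e ∈ E) : e ^ 2 ∈ TT P E := by
  simpa using TT.gen (P := P) P.one_mem he

theorem TT.of_mem {E : Subfield Ω} {p : Ω} (hp : p ∈ P) : p ∈ TT P E := by
  simpa using TT.gen (P := P) (E := E) hp E.one_mem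

theorem TT.mul {E : Subfield Ω} {x y : Ω} (hx : x ∈ TT P E) (hy : y ∈ TT P E) :
    x * y ∈ TT P E := by
  induction hx using AddSubmonoid.closure_induction with
  | zero => simp [zero_mem]
  | add x1 x2 _ _ h1 h2 => rw [add_mul]; exact add_mem h1 h2
  | mem x hx =>
    obtain ⟨p, hp, e, he, rfl⟩ := hx
    induction hy using AddSubmonoid.closure_induction with
    | zero => simp [zero_mem]
    | add x1 x2 _ _ h1 h2 => rw [mul_add]; exact add_mem h1 h2
    | mem y hy =>
      obtain ⟨q, hq, g, hg, rfl⟩ := hy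
      have : p * e ^ 2 * (q * g ^ 2) = (p * q) * (e * g) ^ 2 := by ring
      rw [this]
      exact TT.gen (mul_mem hp hq) (mul_mem he hg)

theorem TT.eq_zero {E : Subfield Ω} (hE : (-1 : Ω) ∉ TT P E) {x : Ω} (hxE : x ∈ E)
    (hx : x ∈ TT P E) (hx' : -x ∈ TT P E) : x = 0 := by
  by_contra h0
  apply hE
  have := TT.mul (TT.mul hx hx') (TT.sq (P := P) (inv_mem hxE))
  have e : x * -x * x⁻¹ ^ 2 = -1 := by field_simp
  rwa [e] at this

/-- Admissible subfields. -/
def Adm (P : Subsemiring Ω) (E : Subfield Ω) : Prop :=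
  (∀ p ∈ P, p ∈ E) ∧ (-1 : Ω) ∉ TT P E

theorem exists_maximal_adm (E0 : Subfield Ω) (h0 : Adm P E0) :
    ∃ E, Adm P E ∧ ∀ E', E ≤ E' → Adm P E' → E' = E := by
  obtain ⟨m, hm, hmax⟩ := zorn_le_nonempty₀ {E : Subfield Ω | Adm P E} (by
    intro c hc hch E hE
    have hdir : DirectedOn (· ≤ ·) c := hch.directedOn
    have hne : c.Nonempty := ⟨E, hE⟩
    refine ⟨sSup c, ⟨fun p hp => ?_, fun h => ?_⟩, fun z hz => le_sSup hz⟩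
    · exact le_sSup hE ((hc hE).1 p hp)
    · have key : ∀ x ∈ TT P (sSup c), ∃ F ∈ c, x ∈ TT P F := by
        intro x hx
        induction hx using AddSubmonoid.closure_induction with
        | zero => exact ⟨E, hE, zero_mem _⟩
        | mem x hx =>
          obtain ⟨p, hp, e, he, rfl⟩ := hx
          obtain ⟨F, hF, heF⟩ := (Subfield.mem_sSup_of_directedOn hne hdir).1 he
          exact ⟨F, hF, TT.gen hp heF⟩
        | add x y _ _ h1 h2 =>
          obtain ⟨F, hF, h1⟩ := h1
          obtain ⟨G, hG, h2⟩ := h2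
          obtain ⟨H, hH, hFH, hGH⟩ := hdir F hF G hG
          have mono : ∀ {A B : Subfield Ω}, A ≤ B → TT P A ≤ TT P B := by
            intro A B hAB
            refine AddSubmonoid.closure_mono ?_
            rintro x ⟨p, hp, e, he, rfl⟩
            exact ⟨p, hp, e, hAB he, rfl⟩
          exact ⟨H, hH, add_mem (mono hFH h1) (mono hGH h2)⟩
      obtain ⟨F, hF, hF1⟩ := key _ h
      exact (hc hF).2 hF1) E0 h0
  refine ⟨m, hmax.1, fun E' hE' hA => ?_⟩
  exact le_antisymm (hmax.2 hA hE') hE'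

variable (P) in
/-- Polynomial version of the weighted sums of squares. -/
noncomputable def TP (E : Subfield Ω) (n : ℕ) : AddSubmonoid E[X] :=
  AddSubmonoid.closure {x | ∃ p : E, (p : Ω) ∈ P ∧ ∃ q : E[X], q.natDegree < n ∧ x = C p * q ^ 2}

theorem TP.natDegree {E : Subfield Ω} {n : ℕ} {s : E[X]} (hs : s ∈ TP P E n) :
    s.natDegree ≤ 2 * n - 2 := by
  induction hs using AddSubmonoid.closure_induction with
  | zero => simp
  | add x y _ _ h1 h2 => exact (natDegree_add_le _ _).trans (max_le h1 h2)
  | mem x hx =>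
    obtain ⟨p, hp, q, hq, rfl⟩ := hx
    refine (natDegree_C_mul_le _ _).trans (natDegree_pow_le.trans ?_)
    omega

theorem TP.eval {E : Subfield Ω} {n : ℕ} {s : E[X]} (hs : s ∈ TP P E n) (x : E) :
    ((s.eval x : E) : Ω) ∈ TT P E := by
  induction hs using AddSubmonoid.closure_induction with
  | zero => simp [zero_mem]
  | add x y _ _ h1 h2 => rw [eval_add]; exact add_mem h1 h2
  | mem y hy =>
    obtain ⟨p, hp, q, hq, rfl⟩ := hy
    simp only [eval_mul, eval_C, eval_pow, Subfield.coe_mul, SubmonoidClass.coe_pow]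
    exact TT.gen hp (SetLike.coe_mem _)

theorem TP.coeff_two {E : Subfield Ω} {s : E[X]} (hs : s ∈ TP P E 2) :
    ((s.coeff 2 : E) : Ω) ∈ TT P E := by
  induction hs using AddSubmonoid.closure_induction with
  | zero => simp [zero_mem]
  | add x y _ _ h1 h2 => rw [coeff_add]; exact add_mem h1 h2
  | mem y hy =>
    obtain ⟨p, hp, q, hq, rfl⟩ := hy
    have : (q ^ 2).coeff 2 = (q.coeff 1) ^ 2 := by
      have := coeff_pow_of_natDegree_le (p := q) (n := 1) (m := 2) (by omega)
      simpa using this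
    simp only [coeff_C_mul, this, Subfield.coe_mul, SubmonoidClass.coe_pow]
    exact TT.gen hp (SetLike.coe_mem _)

theorem adjoin_step {E : Subfield Ω} (hE : Adm P E)
    (hmax : ∀ E', E ≤ E' → Adm P E' → E' = E) (α : Ω) (hα : α ∉ E) (hint : IsIntegral E α) :
    ∃ s ∈ TP P E (minpoly E α).natDegree, minpoly E α ∣ 1 + s := by
  let E' : Subfield Ω := (IntermediateField.adjoin E {α}).toSubfield
  have hEE' : E ≤ E' := fun x hx => (IntermediateField.adjoin E {α}).algebraMap_mem ⟨x, hx⟩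
  have hαE' : α ∈ E' := IntermediateField.mem_adjoin_simple_self E α
  have h1 : (-1 : Ω) ∈ TT P E' := by
    by_contra h
    have := hmax E' hEE' ⟨fun p hp => hEE' (hE.1 p hp), h⟩
    rw [this] at hαE'
    exact hα hαE'
  have hmon := minpoly.monic hint
  have key : ∀ x ∈ TT P E', ∃ s ∈ TP P E (minpoly E α).natDegree, aeval α s = x := by
    intro x hx
    induction hx using AddSubmonoid.closure_induction with
    | zero => exact ⟨0, zero_mem _, by simp⟩
    | add x y _ _ h1 h2 =>
      obtain ⟨s, hs, rfl⟩ := h1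
      obtain ⟨t, ht, rfl⟩ := h2
      exact ⟨s + t, add_mem hs ht, by simp⟩
    | mem x hx =>
      obtain ⟨p, hp, e, he, rfl⟩ := hx
      have he : e ∈ (IntermediateField.adjoin E {α}).toSubalgebra := he
      rw [IntermediateField.adjoin_simple_toSubalgebra_of_isAlgebraic hint.isAlgebraic,
        Algebra.adjoin_singleton_eq_range_aeval] at he
      obtain ⟨q, rfl⟩ := he
      refine ⟨C ⟨p, hE.1 p hp⟩ * (q %ₘ minpoly E α) ^ 2, AddSubmonoid.subset_closure
        ⟨_, hp, _, natDegree_modByMonic_lt _ hmon (minpoly.ne_one _ _), rfl⟩, ?_⟩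
      have : aeval α (q %ₘ minpoly E α) = aeval α q :=
        aeval_modByMonic_eq_self_of_root (minpoly.aeval _ _)
      rw [map_mul, map_pow, this, aeval_C]
      rfl
  obtain ⟨s, hs, hs1⟩ := key _ h1
  refine ⟨s, hs, minpoly.dvd _ _ ?_⟩
  rw [map_add, map_one, hs1]
  ring

theorem mem_or_neg_mem_TT [IsAlgClosed Ω] {E : Subfield Ω} (hE : Adm P E)
    (hmax : ∀ E', E ≤ E' → Adm P E' → E' = E) (a : E) :
    (a : Ω) ∈ TT P E ∨ -(a : Ω) ∈ TT P E := by
  obtain ⟨α, hα⟩ := IsAlgClosed.exists_pow_nat_eq (a : Ω) (n := 2) (by norm_num)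
  by_cases hαE : α ∈ E
  · left
    rw [← hα]
    exact TT.sq hαE
  right
  have hmon : (X ^ 2 - C a : E[X]).Monic := monic_X_pow_sub_C a (by norm_num)
  have hroot : aeval α (X ^ 2 - C a : E[X]) = 0 := by
    simp only [map_sub, map_pow, aeval_X, aeval_C, hα]
    exact sub_self _
  have hint : IsIntegral E α := ⟨_, hmon, hroot⟩
  have hdeg : (X ^ 2 - C a : E[X]).natDegree = 2 := natDegree_X_pow_sub_C
  have hn : 2 ≤ (minpoly E α).natDegree := by
    rw [minpoly.two_le_natDegree_iff hint]
    rintro ⟨x, rfl⟩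
    exact hαE x.2
  have hmin : minpoly E α = X ^ 2 - C a := by
    symm
    exact eq_of_monic_of_dvd_of_natDegree_le (minpoly.monic hint) hmon
      (minpoly.dvd _ _ hroot) (by omega)
  obtain ⟨s, hs, g, hg⟩ := adjoin_step hE hmax α hαE hint
  rw [hmin, hdeg] at hs
  rw [hmin] at hg
  have hsd := TP.natDegree hs
  have h2 := TP.coeff_two hs
  have h0 := TP.eval hs 0
  have hg0 : g.natDegree = 0 := by
    by_cases hgz : g = 0
    · simp [hgz]
    have := natDegree_mul hmon.ne_zero hgz
    rw [← hg, hdeg] at this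
    have h3 : (1 + s).natDegree ≤ 2 := (natDegree_add_le _ _).trans (max_le (by simp) hsd)
    omega
  obtain ⟨c, rfl⟩ : ∃ c, g = C c := ⟨_, eq_C_of_natDegree_eq_zero hg0⟩
  have e2 : s.coeff 2 = c := by
    have := congrArg (fun p => p.coeff 2) hg
    simpa [coeff_one, coeff_C] using this
  have e0 : 1 + s.eval 0 = -a * c := by
    have := congrArg (fun p => p.eval 0) hg
    simpa using this
  rw [e2] at h2
  have hc : (c : Ω) ≠ 0 := by
    intro hc
    have hc : c = 0 := by exact_mod_cast hc
    rw [hc, mul_zero] at e0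
    apply hE.2
    have : s.eval 0 = -1 := by linear_combination e0
    rw [this] at h0
    simpa using h0
  have e0' : 1 + ((s.eval 0 : E) : Ω) = -(a : Ω) * c := by exact_mod_cast congrArg Subtype.val e0
  have := TT.mul (TT.mul (add_mem (TT.of_mem (P := P) (E := E) P.one_mem) h0) h2)
    (TT.sq (P := P) (inv_mem c.2))
  rw [e0'] at this
  have e : -(a : Ω) * c * c * (c : Ω)⁻¹ ^ 2 = -a := by field_simp
  rwa [e] at this

end rcf

section rcf2
open Polynomial

theorem exists_irred_sign {R : Type*} [Field R] [LinearOrder R] [IsStrictOrderedRing R]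
    (p : R[X]) (a b : R) (h : p.eval a * p.eval b < 0) :
    ∃ f : R[X], Irreducible f ∧ f ∣ p ∧ f.eval a * f.eval b < 0 := by
  induction p using WfDvdMonoid.induction_on_irreducible with
  | zero => simp at h
  | unit u hu =>
    obtain ⟨c, -, rfl⟩ := Polynomial.isUnit_iff.1 hu
    simp only [eval_C] at h
    exact absurd h (not_lt.2 (mul_self_nonneg c))
  | mul p f hp hf ih =>
    by_cases hs : f.eval a * f.eval b < 0
    · exact ⟨f, hf, dvd_mul_right _ _, hs⟩
    · have : p.eval a * p.eval b < 0 := by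
        by_contra h'
        push Not at hs h'
        have := mul_nonneg hs h'
        simp only [eval_mul] at h
        nlinarith
      obtain ⟨g, hg, hgp, hgs⟩ := ih this
      exact ⟨g, hg, hgp.mul_left _, hgs⟩

theorem PIVT_of_irred {R : Type*} [Field R] [LinearOrder R] [IsStrictOrderedRing R]
    (H : ∀ f : R[X], Irreducible f → 2 ≤ f.natDegree → ∃ s : R[X], (∀ x, 0 ≤ s.eval x) ∧
      s.natDegree ≤ 2 * f.natDegree - 2 ∧ f ∣ 1 + s) : PIVT R := by
  have key : ∀ n (f : R[X]), f.natDegree = n → Irreducible f → 2 ≤ f.natDegree → ∀ a b : R,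
      ¬ f.eval a * f.eval b < 0 := by
    intro n
    induction n using Nat.strong_induction_on with
    | _ n ih =>
      intro f hn hf h2 a b hab
      obtain ⟨s, hs, hsd, g, hg⟩ := H f hf h2
      have hpos : ∀ x, 0 < f.eval x * g.eval x := by
        intro x
        rw [← eval_mul, ← hg, eval_add, eval_one]
        have := hs x
        linarith
      have hg0 : g ≠ 0 := by
        rintro rfl
        have := hpos 0
        simp at this
      have hgd : g.natDegree < n := by
        have := natDegree_mul hf.ne_zero hg0
        rw [← hg] at this
        have h3 : (1 + s).natDegree ≤ 2 * f.natDegree - 2 :=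
          (natDegree_add_le _ _).trans (max_le (by simp) hsd)
        omega
      have hgs : g.eval a * g.eval b < 0 := by
        have := mul_pos (hpos a) (hpos b)
        by_contra h'
        push Not at h'
        nlinarith [mul_nonneg (neg_nonneg.2 hab.le) h']
      obtain ⟨h, hh, hhg, hhs⟩ := exists_irred_sign g a b hgs
      have hhd : h.natDegree ≤ g.natDegree := natDegree_le_of_dvd hhg hg0
      by_cases h2 : 2 ≤ h.natDegree
      · exact ih h.natDegree (by omega) h rfl hh h2 a b hhs
      · have h1 : h.degree = 1 := by
          have := hh.natDegree_pos
          rw [degree_eq_natDegree hh.ne_zero]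
          have : h.natDegree = 1 := by omega
          rw [this]; rfl
        obtain ⟨x, hx⟩ := exists_root_of_degree_eq_one h1
        have : g.eval x = 0 := by
          obtain ⟨k, rfl⟩ := hhg
          rw [eval_mul, hx.eq_zero, zero_mul]
        have h' := hpos x
        rw [this, mul_zero] at h'
        exact lt_irrefl _ h'
  intro p a b hab h
  obtain ⟨f, hf, hfp, hfs⟩ := exists_irred_sign p a b h
  have hd := hf.natDegree_pos
  have h1 : f.natDegree = 1 := by
    by_contra h1
    exact key _ f rfl hf (by omega) a b hfs
  have hf1 : f = C (f.coeff 1) * X + C (f.coeff 0) := eq_X_add_C_of_natDegree_le_one h1.le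
  generalize f.coeff 1 = c at hf1
  generalize f.coeff 0 = d at hf1
  have hc : c ≠ 0 := by
    rintro rfl
    rw [hf1] at h1
    simp at h1
  have ev : ∀ x, f.eval x = c * (x - (-d / c)) := by
    intro x
    rw [hf1]
    simp only [eval_add, eval_mul, eval_C, eval_X]
    field_simp
    ring
  obtain ⟨r, hr⟩ : ∃ r, r = -d / c := ⟨_, rfl⟩
  rw [← hr] at ev
  have hc2 : 0 < c ^ 2 := by positivity
  rw [ev, ev] at hfs
  have hs : (a - r) * (b - r) < 0 := by
    by_contra h'
    push Not at h'
    nlinarith [mul_nonneg hc2.le h']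
  refine ⟨r, ?_, ?_, ?_⟩
  · by_contra h'
    push Not at h'
    nlinarith [mul_nonneg (sub_nonneg.2 h') (sub_nonneg.2 (h'.trans hab.le))]
  · by_contra h'
    push Not at h'
    nlinarith [mul_nonneg (sub_nonneg.2 h') (sub_nonneg.2 (hab.le.trans h'))]
  · obtain ⟨k, rfl⟩ := hfp
    rw [eval_mul, ev, sub_self, mul_zero, zero_mul]

/-- The cone of nonnegative elements of a maximal admissible subfield. -/
def coneOf {Ω : Type} [Field Ω] {P : Subsemiring Ω} {E : Subfield Ω} (hE : Adm P E) :
    RingCone E where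
  carrier := {x | (x : Ω) ∈ TT P E}
  zero_mem' := zero_mem (TT P E)
  one_mem' := TT.of_mem P.one_mem
  add_mem' := fun {_ _} h1 h2 => (TT P E).add_mem h1 h2
  mul_mem' := fun {_ _} h1 h2 => TT.mul h1 h2
  eq_zero_of_mem_of_neg_mem' := fun {x} h1 h2 => Subtype.ext (TT.eq_zero hE.2 x.2 h1 h2)

theorem exists_rcf {Ω : Type} [Field Ω] [IsAlgClosed Ω] (P : Subsemiring Ω) (E0 : Subfield Ω)
    (h0 : Adm P E0) : ∃ E : Subfield Ω, (∀ p ∈ P, p ∈ E) ∧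
      ∃ (_ : LinearOrder E) (_ : IsStrictOrderedRing E), PIVT E ∧
        ∀ p : E, (p : Ω) ∈ P → 0 ≤ p := by
  classical
  obtain ⟨E, hE, hmax⟩ := exists_maximal_adm E0 h0
  refine ⟨E, hE.1, ?_⟩
  let Cn := coneOf hE
  have hCn : ∀ x : E, x ∈ Cn ↔ (x : Ω) ∈ TT P E := fun x => Iff.rfl
  have : HasMemOrNegMem Cn := ⟨fun a => mem_or_neg_mem_TT hE hmax a⟩
  let lo : LinearOrder E := .mkOfAddGroupCone Cn
  have io : IsOrderedRing E := .mkOfCone Cn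
  have : IsStrictOrderedRing E := IsOrderedRing.toIsStrictOrderedRing E
  have hle : ∀ x : E, 0 ≤ x ↔ (x : Ω) ∈ TT P E := by
    intro x
    change x - 0 ∈ Cn ↔ _
    rw [sub_zero]
    exact hCn x
  refine ⟨lo, inferInstance, PIVT_of_irred fun f hf h2 => ?_, fun p hp => (hle p).2 (TT.of_mem hp)⟩
  obtain ⟨α, hα⟩ := IsAlgClosed.exists_aeval_eq_zero Ω f (by
    rw [degree_eq_natDegree hf.ne_zero]
    intro h
    have : f.natDegree = 0 := by exact_mod_cast h
    omega)
  have hint : IsIntegral E α := IsAlgebraic.isIntegral ⟨f, hf.ne_zero, hα⟩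
  have hass := minpoly.eq_of_irreducible hf hα
  have hmd : (minpoly E α).natDegree = f.natDegree := by
    rw [← hass, natDegree_mul_C (inv_ne_zero (leadingCoeff_ne_zero.2 hf.ne_zero))]
  have hαE : α ∉ E := by
    intro h
    have := (minpoly.two_le_natDegree_iff hint).1 (by omega)
    exact this ⟨⟨α, h⟩, rfl⟩
  obtain ⟨s, hs, hds⟩ := adjoin_step hE hmax α hαE hint
  rw [hmd] at hs
  refine ⟨s, fun x => (hle _).2 (TP.eval hs x), TP.natDegree hs, ?_⟩
  rw [← hass] at hds
  exact (dvd_mul_right _ _).trans hds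

/-- Embedding of a naturally totally ordered cancellative semiring. -/
theorem exists_embedding (L : Type) [CommSemiring L] (hT : natTotOrd L) (hA : addCanc L)
    (hM : mulCanc L) (h01 : (0 : L) ≠ 1) :
    ∃ (R : Type) (_ : Field R) (_ : LinearOrder R) (_ : IsStrictOrderedRing R) (ψ : L →+* R),
      PIVT R ∧ Function.Injective ψ ∧ ∀ l, 0 ≤ ψ l := by
  obtain ⟨D, _, _, i, hi, hD⟩ := exists_diffRing L hT hA hM h01
  let F := FractionRing D
  let Ω := AlgebraicClosure F
  let j : D →+* Ω := (algebraMap F Ω).comp (algebraMap D F)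
  have hj : Function.Injective j :=
    (algebraMap F Ω).injective.comp (IsFractionRing.injective D F)
  let P : Subsemiring Ω := (j.comp i).rangeS
  let E0 : Subfield Ω := (algebraMap F Ω).fieldRange
  have hsq : ∀ d : D, ∃ l, d ^ 2 = i l := by
    intro d
    obtain ⟨l, rfl | rfl⟩ := hD d
    · exact ⟨l ^ 2, by simp⟩
    · exact ⟨l ^ 2, by simp⟩
  have hadm : Adm P E0 := by
    refine ⟨?_, fun h => ?_⟩
    · rintro p ⟨l, rfl⟩
      exact ⟨algebraMap D F (i l), rfl⟩
    · have key : ∀ x ∈ TT P E0, ∃ (l : L) (m : D), m ≠ 0 ∧ x * j m ^ 2 = j (i l) := by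
        intro x hx
        induction hx using AddSubmonoid.closure_induction with
        | zero => exact ⟨0, 1, one_ne_zero, by simp⟩
        | add x y _ _ h1 h2 =>
          obtain ⟨l, m, hm, h1⟩ := h1
          obtain ⟨l', m', hm', h2⟩ := h2
          obtain ⟨k, hk⟩ := hsq m
          obtain ⟨k', hk'⟩ := hsq m'
          refine ⟨l * k' + l' * k, m * m', mul_ne_zero hm hm', ?_⟩
          simp only [map_add, map_mul, ← h1, ← h2, ← hk, ← hk', map_pow]
          ring
        | mem x hx =>
          obtain ⟨p, ⟨l, rfl⟩, e, ⟨e', rfl⟩, rfl⟩ := hx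
          obtain ⟨n, m, hm, rfl⟩ := IsFractionRing.div_surjective (A := D) e'
          have hm0 : m ≠ 0 := nonZeroDivisors.ne_zero hm
          have hjm : j m ≠ 0 := fun h => hm0 (hj (by rw [h, map_zero]))
          obtain ⟨k, hk⟩ := hsq n
          refine ⟨l * k, m, hm0, ?_⟩
          have e1 : algebraMap F Ω (algebraMap D F n / algebraMap D F m) = j n / j m :=
            map_div₀ _ _ _
          rw [e1, map_mul, map_mul, ← hk, map_pow]
          change j (i l) * _ * _ = _
          rw [mul_assoc, ← mul_pow, div_mul_cancel₀ _ hjm]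
      obtain ⟨l, m, hm, h1⟩ := key _ h
      obtain ⟨k, hk⟩ := hsq m
      rw [← map_pow, hk] at h1
      have h2 : i (k + l) = i 0 := by
        apply hj
        rw [map_add, map_add, ← h1, map_zero, map_zero]
        ring
      have h3 : k + l = 0 := hi h2
      have h4 : k = 0 := hT.1 k 0 ⟨l, h3⟩ ⟨k, zero_add k⟩
      rw [h4, map_zero] at hk
      exact hm (pow_eq_zero_iff (two_ne_zero) |>.1 hk)
  obtain ⟨E, hPE, lo, so, hpivt, hnn⟩ := exists_rcf P E0 hadm
  let ψ : L →+* E := (j.comp i).codRestrict E (fun l => hPE _ ⟨l, rfl⟩)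
  refine ⟨E, inferInstance, lo, so, ψ, hpivt, ?_, fun l => hnn _ ⟨l, rfl⟩⟩
  intro x y h
  exact hi (hj (congrArg Subtype.val h))

end rcf2

/-! ## The main theorem -/

/-- Left side of the conditional independence equation. -/
noncomputable def ciL [DecidableEq V] [Fintype V] {Dom : V → Type*}
    [∀ a, Fintype (Dom a)] {K : Type*} [CommSemiring K]
    (σ : CITriple V) (R : Tup Dom (Finset.univ : Finset V) → K)
    (t : Tup Dom (σ.1 ∪ σ.2.1 ∪ σ.2.2)) : K :=
  margin R (Finset.union_subset (Finset.subset_univ σ.1) (Finset.subset_univ σ.2.1))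
      (Tup.restrict Finset.subset_union_left t) *
    margin R (Finset.union_subset (Finset.subset_univ σ.1) (Finset.subset_univ σ.2.2))
      (Tup.restrict (Finset.union_subset
        (Finset.subset_union_left.trans Finset.subset_union_left)
        Finset.subset_union_right) t)

/-- Right side of the conditional independence equation. -/
noncomputable def ciR [DecidableEq V] [Fintype V] {Dom : V → Type*}
    [∀ a, Fintype (Dom a)] {K : Type*} [CommSemiring K]
    (σ : CITriple V) (R : Tup Dom (Finset.univ : Finset V) → K)
    (t : Tup Dom (σ.1 ∪ σ.2.1 ∪ σ.2.2)) : K :=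
  margin R (Finset.union_subset (Finset.union_subset (Finset.subset_univ σ.1)
      (Finset.subset_univ σ.2.1)) (Finset.subset_univ σ.2.2)) t *
    margin R (Finset.subset_univ σ.1)
      (Tup.restrict (Finset.subset_union_left.trans Finset.subset_union_left) t)

theorem satBy_iff [DecidableEq V] [Fintype V] {Dom : V → Type*}
    [∀ a, Fintype (Dom a)] {K : Type*} [CommSemiring K]
    (σ : CITriple V) (R : Tup Dom (Finset.univ : Finset V) → K) :
    CITriple.SatBy σ R ↔ ∀ t, ciL σ R t = ciR σ R t := Iff.rfl

theorem map_margin [DecidableEq V] {Dom : V → Type*}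
    [∀ a, Fintype (Dom a)] {K K' : Type*} [CommSemiring K] [CommSemiring K'] (φ : K →+* K')
    {X Y : Finset V} (R : Tup Dom X → K) (h : Y ⊆ X) (u : Tup Dom Y) :
    φ (margin R h u) = margin (fun t => φ (R t)) h u := by
  simp only [margin, map_sum, apply_ite φ, map_zero]

theorem map_ciL [DecidableEq V] [Fintype V] {Dom : V → Type*}
    [∀ a, Fintype (Dom a)] {K K' : Type*} [CommSemiring K] [CommSemiring K'] (φ : K →+* K')
    (σ : CITriple V) (R : Tup Dom (Finset.univ : Finset V) → K)
    (t : Tup Dom (σ.1 ∪ σ.2.1 ∪ σ.2.2)) : φ (ciL σ R t) = ciL σ (fun t => φ (R t)) t := by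
  simp only [ciL, map_mul, map_margin]

theorem map_ciR [DecidableEq V] [Fintype V] {Dom : V → Type*}
    [∀ a, Fintype (Dom a)] {K K' : Type*} [CommSemiring K] [CommSemiring K'] (φ : K →+* K')
    (σ : CITriple V) (R : Tup Dom (Finset.univ : Finset V) → K)
    (t : Tup Dom (σ.1 ∪ σ.2.1 ∪ σ.2.2)) : φ (ciR σ R t) = ciR σ (fun t => φ (R t)) t := by
  simp only [ciR, map_mul, map_margin]

theorem satBy_map_iff [DecidableEq V] [Fintype V] {Dom : V → Type*}
    [∀ a, Fintype (Dom a)] {K K' : Type*} [CommSemiring K] [CommSemiring K'] (φ : K →+* K')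
    (hφ : Function.Injective φ) (σ : CITriple V) (R : Tup Dom (Finset.univ : Finset V) → K) :
    CITriple.SatBy σ (fun t => φ (R t)) ↔ CITriple.SatBy σ R := by
  simp only [satBy_iff, ← map_ciL, ← map_ciR, hφ.eq_iff]

/-- Transfer of finitely many independence statements between nonnegative relations. -/
theorem transfer_rel [DecidableEq V] [Fintype V] (Dom : V → Type*)
    [∀ a, Fintype (Dom a)] {R₁ R₂ : Type*} [Field R₁] [LinearOrder R₁] [IsStrictOrderedRing R₁]
    [Field R₂] [LinearOrder R₂] [IsStrictOrderedRing R₂] (h₁ : PIVT R₁) (h₂ : PIVT R₂)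
    (W : Finset (CITriple V)) (R : Tup Dom (Finset.univ : Finset V) → R₁) (hR : ∀ t, 0 ≤ R t) :
    ∃ R' : Tup Dom (Finset.univ : Finset V) → R₂, (∀ t, 0 ≤ R' t) ∧
      ∀ σ ∈ W, (CITriple.SatBy σ R ↔ CITriple.SatBy σ R') := by
  classical
  let e := Fintype.equivFin (Tup Dom (Finset.univ : Finset V))
  let G : Tup Dom (Finset.univ : Finset V) → MvPolynomial (Fin _) ℤ :=
    fun t => MvPolynomial.X (e t)
  let S : Finset (MvPolynomial (Fin _) ℤ) := Finset.univ.image (fun i => MvPolynomial.X i) ∪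
    W.biUnion (fun σ => Finset.univ.image (fun t => ciL σ G t - ciR σ G t))
  obtain ⟨b, hb⟩ := transfer_fin h₁ h₂ _ S (fun i => R (e.symm i))
  have hX : ∀ i, SS (R (e.symm i)) (b i) := by
    intro i
    have := hb (MvPolynomial.X i) (Finset.mem_union_left _
      (Finset.mem_image_of_mem _ (Finset.mem_univ i)))
    simpa using this
  refine ⟨fun t => b (e t), fun t => ?_, fun σ hσ => ?_⟩
  · have := (hX (e t)).2
    rw [e.symm_apply_apply] at this
    exact not_lt.1 fun h => not_lt.2 (hR t) (this.2 h)
  · have gen : ∀ (t : Tup Dom (σ.1 ∪ σ.2.1 ∪ σ.2.2)),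
        ciL σ R t = ciR σ R t ↔ ciL σ (fun t => b (e t)) t = ciR σ (fun t => b (e t)) t := by
      intro t
      have := (hb (ciL σ G t - ciR σ G t) (Finset.mem_union_right _ (Finset.mem_biUnion.2
        ⟨σ, hσ, Finset.mem_image_of_mem _ (Finset.mem_univ t)⟩))).zero_iff
      rw [map_sub, map_sub, sub_eq_zero, sub_eq_zero] at this
      have l1 := map_ciL (MvPolynomial.aeval (fun i => R (e.symm i)) :
        MvPolynomial (Fin _) ℤ →ₐ[ℤ] R₁).toRingHom σ G t
      have l2 := map_ciL (MvPolynomial.aeval b : MvPolynomial (Fin _) ℤ →ₐ[ℤ] R₂).toRingHom σ G t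
      have r1 := map_ciR (MvPolynomial.aeval (fun i => R (e.symm i)) :
        MvPolynomial (Fin _) ℤ →ₐ[ℤ] R₁).toRingHom σ G t
      have r2 := map_ciR (MvPolynomial.aeval b : MvPolynomial (Fin _) ℤ →ₐ[ℤ] R₂).toRingHom σ G t
      simp only [AlgHom.toRingHom_eq_coe, RingHom.coe_coe, G, MvPolynomial.aeval_X,
        Equiv.symm_apply_apply] at l1 l2 r1 r2
      rw [← l1, ← l2, ← r1, ← r2]
      exact this
    rw [satBy_iff, satBy_iff]
    exact forall_congr' gen

/-- If `K` embeds in a naturally totally ordered cancellative semiring, then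
CI implication over `ℝ≥0`-relations entails CI implication over `K`-relations. -/
theorem nnrealImplication_to_K
    [DecidableEq V] [Fintype V] (Dom : V → Type*)
    [∀ a, Fintype (Dom a)] [∀ a, Nonempty (Dom a)]
    (K : Type) [CommSemiring K] [Nontrivial K]
    (hembed : ∃ (L : Type) (_ : CommSemiring L) (f : K →+* L),
      Function.Injective f ∧ natTotOrd L ∧ addCanc L ∧ mulCanc L)
    (Sig : Finset (CITriple V)) (τ : CITriple V)
    (hdisj : ∀ σ ∈ insert τ Sig, CITriple.PairwiseDisjoint σ)
    (h : impliesCIOver Dom NNReal (↑Sig) τ) :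
    impliesCIOver Dom K (↑Sig) τ := by
  obtain ⟨L, _, f, hf, hT, hA, hM⟩ := hembed
  have h01 : (0 : L) ≠ 1 := by
    intro h01
    apply zero_ne_one (α := K)
    apply hf
    rw [map_zero, map_one, h01]
  obtain ⟨R₁, _, _, _, ψ, hp, hψ, hnn⟩ := exists_embedding L hT hA hM h01
  intro R hR
  let φ : K →+* R₁ := ψ.comp f
  have hφ : Function.Injective φ := hψ.comp hf
  obtain ⟨R', hR', hiff⟩ := transfer_rel Dom hp PIVT_real (insert τ Sig) (fun t => φ (R t))
    (fun t => hnn _)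
  let R'' : Tup Dom (Finset.univ : Finset V) → NNReal := fun t => ⟨R' t, hR' t⟩
  have hR'' : R' = fun t => NNReal.toRealHom (R'' t) := rfl
  have hinj : Function.Injective NNReal.toRealHom := NNReal.coe_injective
  have hiff' : ∀ σ ∈ insert τ Sig, (CITriple.SatBy σ R ↔ CITriple.SatBy σ R'') := by
    intro σ hσ
    rw [← satBy_map_iff φ hφ, hiff σ hσ, hR'', satBy_map_iff NNReal.toRealHom hinj]
  rw [hiff' τ (Finset.mem_insert_self _ _)]
  apply h
  intro σ hσ
  rw [← hiff' σ (Finset.mem_insert_of_mem hσ)]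
  exact hR σ hσ
end
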